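/- arXiv:1301.1118 — 8 statements merged into one kernel-verified Lean document; each statement's English description precedes it below -/
import Mathlib

section
/- Let p be a prime with p = 11 or p ≥ 19. Then there exists a positive integer d with 8d < p such that −d is a quadratic non-residue modulo p, i.e., there is no integer b with b² ≡ −d (mod p). -/
/-- The least positive quadratic non-residue `n` modulo a prime `p` satisfies
`n (n - 1) ≤ p`. -/
theorem exists_least_nonsquare (p : ℕ) [Fact p.Prime] (hp2 : p ≠ 2) :
    ∃ n : ℕ, 1 < n ∧ ¬ IsSquare (n : ZMod p) ∧ n ≤ p / n + 1 := by
  classical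
  have hex : ∃ n : ℕ, ¬ IsSquare (n : ZMod p) := by
    obtain ⟨a, ha⟩ := FiniteField.exists_nonsquare (F := ZMod p) (by rwa [ZMod.ringChar_zmod_n])
    exact ⟨a.val, by rwa [ZMod.natCast_zmod_val]⟩
  have hn := Nat.find_spec hex
  have hmin : ∀ m < Nat.find hex, IsSquare (m : ZMod p) :=
    fun m hm => not_not.mp (Nat.find_min hex hm)
  generalize Nat.find hex = n at hn hmin
  have hn1 : 1 < n := by
    by_contra! h
    interval_cases n <;> simp at hn
  refine ⟨n, hn1, hn, ?_⟩
  by_contra! hlt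
  have hprod : IsSquare ((p / n + 1 : ℕ) * n : ZMod p) := by
    have hle : p % n ≤ n := (Nat.mod_lt p (by omega)).le
    have hadd : (p / n + 1) * n = p + (n - p % n) := by
      have := Nat.div_add_mod' p n
      rw [add_mul]
      omega
    rw [← Nat.cast_mul, hadd, Nat.cast_add, ZMod.natCast_self, zero_add]
    rcases Nat.eq_zero_or_pos (p % n) with h0 | h0
    · rcases (Nat.dvd_prime Fact.out).mp (Nat.dvd_of_mod_eq_zero h0) with h | h
      · omega
      · exact absurd (by simp [h]) hn
    · exact hmin _ (by omega)
  have hm0 : ((p / n + 1 : ℕ) : ZMod p) ≠ 0 := by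
    rw [Ne, ZMod.natCast_eq_zero_iff]
    intro h
    have hle := Nat.le_of_dvd (Nat.succ_pos _) h
    have := Nat.div_le_div_left (a := p) (show 2 ≤ n from hn1) two_pos
    have := (Fact.out : p.Prime).two_le
    omega
  apply hn
  have := hprod.div (hmin _ hlt)
  rwa [mul_div_cancel_left₀ _ hm0] at this

theorem exists_neg_nonsquare_of_le (p : ℕ) (hp : p.Prime) (hP : p = 11 ∨ 19 ≤ p)
    (hle : p ≤ 64) : ∃ d : ℕ, 0 < d ∧ 8 * d < p ∧ ¬ IsSquare (-d : ZMod p) := by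
  have h11 : 11 ≤ p := by omega
  interval_cases p <;> first
    | (exfalso; revert hp; norm_num; done)
    | omega
    | (refine ⟨1, by norm_num, by norm_num, ?_⟩; rintro ⟨x, hx⟩; revert x; decide)
    | (refine ⟨2, by norm_num, by norm_num, ?_⟩; rintro ⟨x, hx⟩; revert x; decide)
    | (refine ⟨3, by norm_num, by norm_num, ?_⟩; rintro ⟨x, hx⟩; revert x; decide)

/-- For every prime `p` with `p = 11` or `p ≥ 19`, there exists a positive
integer `d` with `8 d < p` such that `-d` is a quadratic non-residue modulo `p`,
i.e. there is no integer `b` with `b² ≡ -d (mod p)`. -/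
theorem exists_small_nonresidue (p : ℕ) (hp : p.Prime) (hP : p = 11 ∨ 19 ≤ p) :
    ∃ d : ℤ, 0 < d ∧ 8 * d < (p : ℤ) ∧ ∀ b : ℤ, ¬ (b ^ 2 ≡ -d [ZMOD p]) := by
  have : Fact p.Prime := ⟨hp⟩
  by_contra! hcon
  have hsq : ∀ d : ℕ, 0 < d → 8 * d < p → IsSquare (-d : ZMod p) := by
    intro d hd hdp
    obtain ⟨b, hb⟩ := hcon d (by exact_mod_cast hd) (by exact_mod_cast hdp)
    have := (ZMod.intCast_eq_intCast_iff _ _ _).mpr hb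
    push_cast at this
    exact ⟨b, by rw [← this, sq]⟩
  have h1 := hsq 1 one_pos (by omega)
  obtain ⟨n, hn1, hn, hle⟩ := exists_least_nonsquare p (by omega)
  have hnp : p ≤ 8 * n := by
    by_contra! h
    have := h1.mul (hsq n (by omega) h)
    exact hn (by simpa using this)
  have hp64 : p ≤ 64 := by
    have h2 : (n - 1) * n ≤ p := (Nat.le_div_iff_mul_le (by omega)).mp (by omega)
    have h3 : n - 1 ≤ 8 := Nat.le_of_mul_le_mul_right (h2.trans hnp) (by omega)
    have h4 : n ≠ 9 := by
      rintro rfl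
      exact hn ⟨3, by norm_num⟩
    omega
  obtain ⟨d, hd, hdp, hd'⟩ := exists_neg_nonsquare_of_le p hp hP hp64
  exact hd' (hsq d hd hdp)
end

section
/- Let p be a prime with p ≥ 13 and p ≠ 23. Then there exists a positive integer d with 8d < p such that −d is a quadratic residue modulo p, i.e., there exists an integer b with b² ≡ −d (mod p). -/
/-- A natural number `n < p` that is the least one not a square modulo the prime `p` satisfies
`n (n - 1) < p`. -/
theorem least_nonsquare_mul_lt {p n : ℕ} [hp : Fact p.Prime] (hnp : n < p)
    (hn : ¬ IsSquare (n : ZMod p)) (hmin : ∀ k < n, IsSquare (k : ZMod p)) :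
    n * (n - 1) < p := by
  have hn0 : n ≠ 0 := by
    rintro rfl
    simp at hn
  have hn1 : n ≠ 1 := by
    rintro rfl
    simp at hn
  have hr : 0 < p % n := by
    refine Nat.pos_of_ne_zero fun h => ?_
    rcases (Nat.dvd_prime hp.out).mp (Nat.dvd_of_mod_eq_zero h) with h | h <;> omega
  have hdiv : n * (p / n) + p % n = p := Nat.div_add_mod p n
  have hrn : p % n < n := Nat.mod_lt _ (by omega)
  have hq : n ≤ p / n + 1 := by
    by_contra! hlt
    have hm0 : ((p / n + 1 : ℕ) : ZMod p) ≠ 0 := by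
      rw [Ne, ZMod.natCast_eq_zero_iff]
      intro h
      have := Nat.le_of_dvd (Nat.succ_pos _) h
      omega
    have hmul : n * (p / n + 1) = p + (n - p % n) := by
      rw [mul_add]
      omega
    have hcast : (n : ZMod p) * ((p / n + 1 : ℕ) : ZMod p) = ((n - p % n : ℕ) : ZMod p) := by
      rw [← Nat.cast_mul, hmul, Nat.cast_add, ZMod.natCast_self, zero_add]
    apply hn
    rw [eq_div_of_mul_eq hm0 hcast]
    exact (hmin _ (by omega)).div (hmin _ hlt)
  have : n * (n - 1) ≤ n * (p / n) := Nat.mul_le_mul_left _ (by omega)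
  omega

/-- In a finite field, the product of two nonsquares is a square. -/
theorem FiniteField.isSquare_mul_of_not_isSquare {F : Type*} [Field F] [Fintype F]
    [DecidableEq F] {a b : F} (ha : ¬ IsSquare a) (hb : ¬ IsSquare b) : IsSquare (a * b) := by
  have hF : ringChar F ≠ 2 := fun h => ha (FiniteField.isSquare_of_char_two h a)
  have hab : a * b ≠ 0 := mul_ne_zero (by rintro rfl; simp at ha) (by rintro rfl; simp at hb)
  rw [← quadraticChar_one_iff_isSquare hab, map_mul,
    (quadraticChar_neg_one_iff_not_isSquare).mpr ha,
    (quadraticChar_neg_one_iff_not_isSquare).mpr hb]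
  norm_num

/-- For every prime `p` with `p ≥ 13` and `p ≠ 23`, there exists a positive
integer `d` with `8 d < p` such that `-d` is a quadratic residue modulo `p`,
i.e. there exists an integer `b` with `b² ≡ -d (mod p)`. -/
theorem exists_small_residue (p : ℕ) (hp : p.Prime) (hP : 13 ≤ p) (hP' : p ≠ 23) :
    ∃ d : ℤ, 0 < d ∧ 8 * d < (p : ℤ) ∧ ∃ b : ℤ, b ^ 2 ≡ -d [ZMOD p] := by
  have h31 : IsSquare (-((3 : ℕ) : ZMod 31)) := ⟨11, by decide⟩
  have h47 : IsSquare (-((5 : ℕ) : ZMod 47)) := ⟨18, by decide⟩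
  have : Fact p.Prime := ⟨hp⟩
  suffices h : ∃ d : ℕ, 0 < d ∧ 8 * d < p ∧ IsSquare (-(d : ZMod p)) by
    obtain ⟨d, hd, hdp, c, hc⟩ := h
    refine ⟨d, by exact_mod_cast hd, by exact_mod_cast hdp, (c.val : ℤ), ?_⟩
    rw [← ZMod.intCast_eq_intCast_iff]
    simp [hc, sq]
  have hodd : p % 2 = 1 := Nat.odd_iff.mp (hp.odd_of_ne_two (by omega))
  by_cases h4 : p % 4 = 3
  swap
  · exact ⟨1, by omega, by omega, by simpa using ZMod.exists_sq_eq_neg_one_iff.mpr h4⟩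
  by_cases h8 : p % 8 = 3
  · exact ⟨2, by omega, by omega,
      by simpa using (ZMod.exists_sq_eq_neg_two_iff (by omega)).mpr (Or.inr h8)⟩
  by_cases hsmall : p < 65
  · have : p = 31 ∨ p = 39 ∨ p = 47 ∨ p = 55 ∨ p = 63 ∨ p = 15 := by omega
    rcases this with rfl | rfl | rfl | rfl | rfl | rfl
    · exact ⟨3, by norm_num, by norm_num, h31⟩
    · norm_num at hp
    · exact ⟨5, by norm_num, by norm_num, h47⟩
    all_goals norm_num at hp
  have hneg : ¬ IsSquare (-1 : ZMod p) := fun h => ZMod.exists_sq_eq_neg_one_iff.mp h h4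
  have hpred : ¬ IsSquare ((p - 1 : ℕ) : ZMod p) := by
    simpa [Nat.cast_sub hp.one_le] using hneg
  classical
  have hex : ∃ n : ℕ, ¬ IsSquare (n : ZMod p) := ⟨p - 1, hpred⟩
  obtain ⟨n, hn, hnle, hmin⟩ : ∃ n : ℕ, ¬ IsSquare (n : ZMod p) ∧ n ≤ p - 1 ∧
      ∀ k < n, IsSquare (k : ZMod p) :=
    ⟨Nat.find hex, Nat.find_spec hex, Nat.find_min' hex hpred,
      fun k hk => not_not.mp (Nat.find_min hex hk)⟩
  have hlt := least_nonsquare_mul_lt (by omega) hn hmin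
  refine ⟨n, Nat.pos_of_ne_zero ?_, ?_, ?_⟩
  · rintro rfl
    simp at hn
  · rcases le_or_gt n 8 with h | h
    · omega
    · calc 8 * n = n * 8 := mul_comm _ _
        _ ≤ n * (n - 1) := Nat.mul_le_mul_left _ (by omega)
        _ < p := hlt
  · simpa using FiniteField.isSquare_mul_of_not_isSquare hneg hn
end

section
/- Let (L, B) be a nondegenerate ℤ-lattice whose bilinear form is negative definite (B(v,v) < 0 for all v ≠ 0). Let p be an odd prime and d a positive integer with 8d < p. Let K and N be submodules of L such that: B(x, y) = 0 for all x ∈ K and y ∈ N; p divides B(x, y) for all x, y ∈ K; N is a primitive submodule of L (L/N is torsion-free); N contains no vector w with B(w,w) = −2; and for every v ∈ L one has 4d·v ∈ K + N. Then L contains no vector v with B(v,v) = −2. -/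
/-- Let `(L, B)` be a nondegenerate negative definite ℤ-lattice, `p` an odd
prime and `d` a positive integer with `8 d < p`.  Suppose `K` and `N` are submodules of `L`
such that `K ⊥ N`, the form is divisible by `p` on `K`, `N` is primitive in `L`,
`N` contains no vector of square `-2`, and `4 d · v ∈ K + N` for every `v ∈ L`.
Then `L` contains no vector of square `-2`. -/
theorem no_minus_two_vector_of_glueing
    (L : Type*) [AddCommGroup L] [Module ℤ L] [Module.Free ℤ L] [Module.Finite ℤ L]
    (B : L →ₗ[ℤ] L →ₗ[ℤ] ℤ)
    (hsymm : ∀ x y : L, B x y = B y x)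
    (hnondeg : ∀ v : L, (∀ w : L, B v w = 0) → v = 0)
    (hneg : ∀ v : L, v ≠ 0 → B v v < 0)
    (p : ℕ) (hp : p.Prime) (hodd : p ≠ 2)
    (d : ℤ) (hd : 0 < d) (hdp : 8 * d < (p : ℤ))
    (K N : Submodule ℤ L)
    (horth : ∀ x ∈ K, ∀ y ∈ N, B x y = 0)
    (hKdiv : ∀ x ∈ K, ∀ y ∈ K, (p : ℤ) ∣ B x y)
    (hNprim : ∀ (n : ℤ) (x : L ⧸ N), n • x = 0 → n = 0 ∨ x = 0)
    (hN : ∀ w ∈ N, B w w ≠ -2)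
    (hgen : ∀ v : L, (4 * d) • v ∈ K ⊔ N) :
    ∀ v : L, B v v ≠ -2 := by
  obtain rfl : ‹Module ℤ L› = AddCommGroup.toIntModule L := Subsingleton.elim _ _
  intro v hv
  obtain ⟨k, hk, n, hn, hkn⟩ := Submodule.mem_sup.mp (hgen v)
  have hp' : Prime (p : ℤ) := Nat.prime_iff_prime_int.mp hp
  have hcop : IsCoprime (p : ℤ) (4 * d) := by
    rw [hp'.irreducible.coprime_iff_not_dvd]
    exact fun h => absurd (Int.le_of_dvd (by positivity) h) (by linarith)
  have hknorth : B k n = 0 := horth k hk n hn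
  have hnkorth : B n k = 0 := (hsymm n k).trans hknorth
  have hkk : 4 * d * B v k = B k k := by
    have h := congrArg (fun x => B x k) hkn
    simp only [map_add, map_smul, LinearMap.add_apply, LinearMap.smul_apply, smul_eq_mul,
      hnkorth] at h
    linarith
  have hsum : B k k + B n n = -32 * d ^ 2 := by
    have h := congrArg (fun x => B x x) hkn
    simp only [map_add, map_smul, LinearMap.add_apply, LinearMap.smul_apply, smul_eq_mul,
      hnkorth, hknorth, hv] at h
    linarith
  have hnn : B n n ≤ 0 := by
    rcases eq_or_ne n 0 with rfl | h
    · simp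
    · exact (hneg n h).le
  have hk0 : k = 0 := by
    by_contra h
    have hdvd : (p : ℤ) * (4 * d) ∣ -B k k :=
      (hcop.mul_dvd (hKdiv k hk k hk) ⟨_, hkk.symm⟩).neg_right
    have hle := Int.le_of_dvd (by linarith [hneg k h]) hdvd
    nlinarith
  have hmem : (4 * d) • v ∈ N := by
    rw [← hkn, hk0, zero_add]
    exact hn
  have hquot : (4 * d) • (N.mkQ v) = 0 := by
    rw [← map_zsmul]
    exact (Submodule.Quotient.mk_eq_zero N).mpr hmem
  rcases hNprim (4 * d) (N.mkQ v) hquot with h | h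
  · linarith
  · exact hN v ((Submodule.Quotient.mk_eq_zero N).mp h) hv
end

section
/- For every primitive embedding of Γ(2) = U(2) ⊕ E8(2) into the K3 lattice Λ = U ⊕ U ⊕ U ⊕ E8 ⊕ E8, the orthogonal complement of the image in Λ is isometric to U ⊕ U(2) ⊕ E8(2). -/
open Matrix

/-- Gram matrix of the K3 lattice `Λ = U ⊕ U ⊕ U ⊕ E8 ⊕ E8`. -/
def gramK3 : Matrix (Fin 22) (Fin 22) ℤ :=
  !![0, 1, 0, 0, 0, 0, 0, 0, 0, 0, 0, 0, 0, 0, 0, 0, 0, 0, 0, 0, 0, 0;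
     1, 0, 0, 0, 0, 0, 0, 0, 0, 0, 0, 0, 0, 0, 0, 0, 0, 0, 0, 0, 0, 0;
     0, 0, 0, 1, 0, 0, 0, 0, 0, 0, 0, 0, 0, 0, 0, 0, 0, 0, 0, 0, 0, 0;
     0, 0, 1, 0, 0, 0, 0, 0, 0, 0, 0, 0, 0, 0, 0, 0, 0, 0, 0, 0, 0, 0;
     0, 0, 0, 0, 0, 1, 0, 0, 0, 0, 0, 0, 0, 0, 0, 0, 0, 0, 0, 0, 0, 0;
     0, 0, 0, 0, 1, 0, 0, 0, 0, 0, 0, 0, 0, 0, 0, 0, 0, 0, 0, 0, 0, 0;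
     0, 0, 0, 0, 0, 0, -2, 1, 0, 0, 0, 0, 0, 0, 0, 0, 0, 0, 0, 0, 0, 0;
     0, 0, 0, 0, 0, 0, 1, -2, 1, 0, 0, 0, 0, 0, 0, 0, 0, 0, 0, 0, 0, 0;
     0, 0, 0, 0, 0, 0, 0, 1, -2, 1, 1, 0, 0, 0, 0, 0, 0, 0, 0, 0, 0, 0;
     0, 0, 0, 0, 0, 0, 0, 0, 1, -2, 0, 0, 0, 0, 0, 0, 0, 0, 0, 0, 0, 0;
     0, 0, 0, 0, 0, 0, 0, 0, 1, 0, -2, 1, 0, 0, 0, 0, 0, 0, 0, 0, 0, 0;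
     0, 0, 0, 0, 0, 0, 0, 0, 0, 0, 1, -2, 1, 0, 0, 0, 0, 0, 0, 0, 0, 0;
     0, 0, 0, 0, 0, 0, 0, 0, 0, 0, 0, 1, -2, 1, 0, 0, 0, 0, 0, 0, 0, 0;
     0, 0, 0, 0, 0, 0, 0, 0, 0, 0, 0, 0, 1, -2, 0, 0, 0, 0, 0, 0, 0, 0;
     0, 0, 0, 0, 0, 0, 0, 0, 0, 0, 0, 0, 0, 0, -2, 1, 0, 0, 0, 0, 0, 0;
     0, 0, 0, 0, 0, 0, 0, 0, 0, 0, 0, 0, 0, 0, 1, -2, 1, 0, 0, 0, 0, 0;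
     0, 0, 0, 0, 0, 0, 0, 0, 0, 0, 0, 0, 0, 0, 0, 1, -2, 1, 1, 0, 0, 0;
     0, 0, 0, 0, 0, 0, 0, 0, 0, 0, 0, 0, 0, 0, 0, 0, 1, -2, 0, 0, 0, 0;
     0, 0, 0, 0, 0, 0, 0, 0, 0, 0, 0, 0, 0, 0, 0, 0, 1, 0, -2, 1, 0, 0;
     0, 0, 0, 0, 0, 0, 0, 0, 0, 0, 0, 0, 0, 0, 0, 0, 0, 0, 1, -2, 1, 0;
     0, 0, 0, 0, 0, 0, 0, 0, 0, 0, 0, 0, 0, 0, 0, 0, 0, 0, 0, 1, -2, 1;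
     0, 0, 0, 0, 0, 0, 0, 0, 0, 0, 0, 0, 0, 0, 0, 0, 0, 0, 0, 0, 1, -2]

/-- Gram matrix of the Enriques lattice twisted by 2, `Γ(2) = U(2) ⊕ E8(2)`. -/
def gramGamma2 : Matrix (Fin 10) (Fin 10) ℤ :=
  !![0, 2, 0, 0, 0, 0, 0, 0, 0, 0;
     2, 0, 0, 0, 0, 0, 0, 0, 0, 0;
     0, 0, -4, 2, 0, 0, 0, 0, 0, 0;
     0, 0, 2, -4, 2, 0, 0, 0, 0, 0;
     0, 0, 0, 2, -4, 2, 2, 0, 0, 0;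
     0, 0, 0, 0, 2, -4, 0, 0, 0, 0;
     0, 0, 0, 0, 2, 0, -4, 2, 0, 0;
     0, 0, 0, 0, 0, 0, 2, -4, 2, 0;
     0, 0, 0, 0, 0, 0, 0, 2, -4, 2;
     0, 0, 0, 0, 0, 0, 0, 0, 2, -4]

/-- Gram matrix of the lattice `U ⊕ U(2) ⊕ E8(2)`. -/
def gramUU2E82 : Matrix (Fin 12) (Fin 12) ℤ :=
  !![0, 1, 0, 0, 0, 0, 0, 0, 0, 0, 0, 0;
     1, 0, 0, 0, 0, 0, 0, 0, 0, 0, 0, 0;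
     0, 0, 0, 2, 0, 0, 0, 0, 0, 0, 0, 0;
     0, 0, 2, 0, 0, 0, 0, 0, 0, 0, 0, 0;
     0, 0, 0, 0, -4, 2, 0, 0, 0, 0, 0, 0;
     0, 0, 0, 0, 2, -4, 2, 0, 0, 0, 0, 0;
     0, 0, 0, 0, 0, 2, -4, 2, 2, 0, 0, 0;
     0, 0, 0, 0, 0, 0, 2, -4, 0, 0, 0, 0;
     0, 0, 0, 0, 0, 0, 2, 0, -4, 2, 0, 0;
     0, 0, 0, 0, 0, 0, 0, 0, 2, -4, 2, 0;
     0, 0, 0, 0, 0, 0, 0, 0, 0, 2, -4, 2;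
     0, 0, 0, 0, 0, 0, 0, 0, 0, 0, 2, -4]

/-- The bilinear form of the K3 lattice. -/
def bK3 (v w : Fin 22 → ℤ) : ℤ := v ⬝ᵥ (gramK3 *ᵥ w)

/-- The bilinear form of `Γ(2) = U(2) ⊕ E8(2)`. -/
def bGamma2 (v w : Fin 10 → ℤ) : ℤ := v ⬝ᵥ (gramGamma2 *ᵥ w)

/-- The bilinear form of `U ⊕ U(2) ⊕ E8(2)`. -/
def bUU2E82 (v w : Fin 12 → ℤ) : ℤ := v ⬝ᵥ (gramUU2E82 *ᵥ w)

/-- The orthogonal complement in the K3 lattice of the image of a linear map. -/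
def orthComplK3 (f : (Fin 10 → ℤ) →ₗ[ℤ] (Fin 22 → ℤ)) : Submodule ℤ (Fin 22 → ℤ) where
  carrier := {v | ∀ u : Fin 10 → ℤ, bK3 v (f u) = 0}
  add_mem' := by
    intro a b ha hb u
    simp only [bK3, add_dotProduct] at *
    rw [ha u, hb u, add_zero]
  zero_mem' := by
    intro u
    simp [bK3]
  smul_mem' := by
    intro c v hv u
    simp only [bK3, smul_eq_mul, smul_dotProduct] at *
    rw [hv u, mul_zero]

/-- Gram matrix of the Enriques lattice `Γ = U ⊕ E8`. -/
def gramGamma : Matrix (Fin 10) (Fin 10) ℤ :=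
  !![0, 1, 0, 0, 0, 0, 0, 0, 0, 0;
     1, 0, 0, 0, 0, 0, 0, 0, 0, 0;
     0, 0, -2, 1, 0, 0, 0, 0, 0, 0;
     0, 0, 1, -2, 1, 0, 0, 0, 0, 0;
     0, 0, 0, 1, -2, 1, 1, 0, 0, 0;
     0, 0, 0, 0, 1, -2, 0, 0, 0, 0;
     0, 0, 0, 0, 1, 0, -2, 1, 0, 0;
     0, 0, 0, 0, 0, 0, 1, -2, 1, 0;
     0, 0, 0, 0, 0, 0, 0, 1, -2, 1;
     0, 0, 0, 0, 0, 0, 0, 0, 1, -2]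

/-- The inverse of `gramGamma`. -/
def gramGammaInv : Matrix (Fin 10) (Fin 10) ℤ :=
  !![0, 1, 0, 0, 0, 0, 0, 0, 0, 0;
     1, 0, 0, 0, 0, 0, 0, 0, 0, 0;
     0, 0, -4, -7, -10, -5, -8, -6, -4, -2;
     0, 0, -7, -14, -20, -10, -16, -12, -8, -4;
     0, 0, -10, -20, -30, -15, -24, -18, -12, -6;
     0, 0, -5, -10, -15, -8, -12, -9, -6, -3;
     0, 0, -8, -16, -24, -12, -20, -15, -10, -5;
     0, 0, -6, -12, -18, -9, -15, -12, -8, -4;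
     0, 0, -4, -8, -12, -6, -10, -8, -6, -3;
     0, 0, -2, -4, -6, -3, -5, -4, -3, -2]

/-- The inverse of `gramK3`. -/
def gramK3Inv : Matrix (Fin 22) (Fin 22) ℤ :=
  !![0, 1, 0, 0, 0, 0, 0, 0, 0, 0, 0, 0, 0, 0, 0, 0, 0, 0, 0, 0, 0, 0;
     1, 0, 0, 0, 0, 0, 0, 0, 0, 0, 0, 0, 0, 0, 0, 0, 0, 0, 0, 0, 0, 0;
     0, 0, 0, 1, 0, 0, 0, 0, 0, 0, 0, 0, 0, 0, 0, 0, 0, 0, 0, 0, 0, 0;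
     0, 0, 1, 0, 0, 0, 0, 0, 0, 0, 0, 0, 0, 0, 0, 0, 0, 0, 0, 0, 0, 0;
     0, 0, 0, 0, 0, 1, 0, 0, 0, 0, 0, 0, 0, 0, 0, 0, 0, 0, 0, 0, 0, 0;
     0, 0, 0, 0, 1, 0, 0, 0, 0, 0, 0, 0, 0, 0, 0, 0, 0, 0, 0, 0, 0, 0;
     0, 0, 0, 0, 0, 0, -4, -7, -10, -5, -8, -6, -4, -2, 0, 0, 0, 0, 0, 0, 0, 0;
     0, 0, 0, 0, 0, 0, -7, -14, -20, -10, -16, -12, -8, -4, 0, 0, 0, 0, 0, 0, 0, 0;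
     0, 0, 0, 0, 0, 0, -10, -20, -30, -15, -24, -18, -12, -6, 0, 0, 0, 0, 0, 0, 0, 0;
     0, 0, 0, 0, 0, 0, -5, -10, -15, -8, -12, -9, -6, -3, 0, 0, 0, 0, 0, 0, 0, 0;
     0, 0, 0, 0, 0, 0, -8, -16, -24, -12, -20, -15, -10, -5, 0, 0, 0, 0, 0, 0, 0, 0;
     0, 0, 0, 0, 0, 0, -6, -12, -18, -9, -15, -12, -8, -4, 0, 0, 0, 0, 0, 0, 0, 0;
     0, 0, 0, 0, 0, 0, -4, -8, -12, -6, -10, -8, -6, -3, 0, 0, 0, 0, 0, 0, 0, 0;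
     0, 0, 0, 0, 0, 0, -2, -4, -6, -3, -5, -4, -3, -2, 0, 0, 0, 0, 0, 0, 0, 0;
     0, 0, 0, 0, 0, 0, 0, 0, 0, 0, 0, 0, 0, 0, -4, -7, -10, -5, -8, -6, -4, -2;
     0, 0, 0, 0, 0, 0, 0, 0, 0, 0, 0, 0, 0, 0, -7, -14, -20, -10, -16, -12, -8, -4;
     0, 0, 0, 0, 0, 0, 0, 0, 0, 0, 0, 0, 0, 0, -10, -20, -30, -15, -24, -18, -12, -6;
     0, 0, 0, 0, 0, 0, 0, 0, 0, 0, 0, 0, 0, 0, -5, -10, -15, -8, -12, -9, -6, -3;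
     0, 0, 0, 0, 0, 0, 0, 0, 0, 0, 0, 0, 0, 0, -8, -16, -24, -12, -20, -15, -10, -5;
     0, 0, 0, 0, 0, 0, 0, 0, 0, 0, 0, 0, 0, 0, -6, -12, -18, -9, -15, -12, -8, -4;
     0, 0, 0, 0, 0, 0, 0, 0, 0, 0, 0, 0, 0, 0, -4, -8, -12, -6, -10, -8, -6, -3;
     0, 0, 0, 0, 0, 0, 0, 0, 0, 0, 0, 0, 0, 0, -2, -4, -6, -3, -5, -4, -3, -2]

/-- The columns are an orthogonal rational basis for `gramGamma`. -/
def orthBasis : Matrix (Fin 10) (Fin 10) ℤ :=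
  !![1, 1, 0, 0, 0, 0, 0, 0, 0, 0;
     1, -1, 0, 0, 0, 0, 0, 0, 0, 0;
     0, 0, 1, 1, 1, 1, 2, 2, 2, 2;
     0, 0, 0, 2, 2, 2, 4, 4, 4, 4;
     0, 0, 0, 0, 3, 3, 6, 6, 6, 6;
     0, 0, 0, 0, 0, 4, 3, 3, 3, 3;
     0, 0, 0, 0, 0, 0, 5, 5, 5, 5;
     0, 0, 0, 0, 0, 0, 0, 4, 4, 4;
     0, 0, 0, 0, 0, 0, 0, 0, 3, 3;
     0, 0, 0, 0, 0, 0, 0, 0, 0, 2]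

/-- The inverse of `orthBasis`, multiplied by 60. -/
def orthBasisInv : Matrix (Fin 10) (Fin 10) ℤ :=
  !![30, 30, 0, 0, 0, 0, 0, 0, 0, 0;
     30, -30, 0, 0, 0, 0, 0, 0, 0, 0;
     0, 0, 60, -30, 0, 0, 0, 0, 0, 0;
     0, 0, 0, 30, -20, 0, 0, 0, 0, 0;
     0, 0, 0, 0, 20, -15, -15, 0, 0, 0;
     0, 0, 0, 0, 0, 15, -9, 0, 0, 0;
     0, 0, 0, 0, 0, 0, 12, -15, 0, 0;
     0, 0, 0, 0, 0, 0, 0, 15, -20, 0;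
     0, 0, 0, 0, 0, 0, 0, 0, 20, -30;
     0, 0, 0, 0, 0, 0, 0, 0, 0, 30]

/-- The diagonal embedding of `Γ(2)` into the K3 lattice. -/
def diagEmb : Matrix (Fin 22) (Fin 10) ℤ :=
  !![0, 0, 0, 0, 0, 0, 0, 0, 0, 0;
     0, 0, 0, 0, 0, 0, 0, 0, 0, 0;
     1, 0, 0, 0, 0, 0, 0, 0, 0, 0;
     0, 1, 0, 0, 0, 0, 0, 0, 0, 0;
     1, 0, 0, 0, 0, 0, 0, 0, 0, 0;
     0, 1, 0, 0, 0, 0, 0, 0, 0, 0;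
     0, 0, 1, 0, 0, 0, 0, 0, 0, 0;
     0, 0, 0, 1, 0, 0, 0, 0, 0, 0;
     0, 0, 0, 0, 1, 0, 0, 0, 0, 0;
     0, 0, 0, 0, 0, 1, 0, 0, 0, 0;
     0, 0, 0, 0, 0, 0, 1, 0, 0, 0;
     0, 0, 0, 0, 0, 0, 0, 1, 0, 0;
     0, 0, 0, 0, 0, 0, 0, 0, 1, 0;
     0, 0, 0, 0, 0, 0, 0, 0, 0, 1;
     0, 0, 1, 0, 0, 0, 0, 0, 0, 0;
     0, 0, 0, 1, 0, 0, 0, 0, 0, 0;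
     0, 0, 0, 0, 1, 0, 0, 0, 0, 0;
     0, 0, 0, 0, 0, 1, 0, 0, 0, 0;
     0, 0, 0, 0, 0, 0, 1, 0, 0, 0;
     0, 0, 0, 0, 0, 0, 0, 1, 0, 0;
     0, 0, 0, 0, 0, 0, 0, 0, 1, 0;
     0, 0, 0, 0, 0, 0, 0, 0, 0, 1]

/-- The antidiagonal embedding of `Γ(2)` into the K3 lattice. -/
def antiEmb : Matrix (Fin 22) (Fin 10) ℤ :=
  !![0, 0, 0, 0, 0, 0, 0, 0, 0, 0;
     0, 0, 0, 0, 0, 0, 0, 0, 0, 0;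
     1, 0, 0, 0, 0, 0, 0, 0, 0, 0;
     0, 1, 0, 0, 0, 0, 0, 0, 0, 0;
     -1, 0, 0, 0, 0, 0, 0, 0, 0, 0;
     0, -1, 0, 0, 0, 0, 0, 0, 0, 0;
     0, 0, 1, 0, 0, 0, 0, 0, 0, 0;
     0, 0, 0, 1, 0, 0, 0, 0, 0, 0;
     0, 0, 0, 0, 1, 0, 0, 0, 0, 0;
     0, 0, 0, 0, 0, 1, 0, 0, 0, 0;
     0, 0, 0, 0, 0, 0, 1, 0, 0, 0;
     0, 0, 0, 0, 0, 0, 0, 1, 0, 0;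
     0, 0, 0, 0, 0, 0, 0, 0, 1, 0;
     0, 0, 0, 0, 0, 0, 0, 0, 0, 1;
     0, 0, -1, 0, 0, 0, 0, 0, 0, 0;
     0, 0, 0, -1, 0, 0, 0, 0, 0, 0;
     0, 0, 0, 0, -1, 0, 0, 0, 0, 0;
     0, 0, 0, 0, 0, -1, 0, 0, 0, 0;
     0, 0, 0, 0, 0, 0, -1, 0, 0, 0;
     0, 0, 0, 0, 0, 0, 0, -1, 0, 0;
     0, 0, 0, 0, 0, 0, 0, 0, -1, 0;
     0, 0, 0, 0, 0, 0, 0, 0, 0, -1]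

/-- The projection of the K3 lattice onto the first copy of `Γ`. -/
def firstProj : Matrix (Fin 10) (Fin 22) ℤ :=
  !![0, 0, 1, 0, 0, 0, 0, 0, 0, 0, 0, 0, 0, 0, 0, 0, 0, 0, 0, 0, 0, 0;
     0, 0, 0, 1, 0, 0, 0, 0, 0, 0, 0, 0, 0, 0, 0, 0, 0, 0, 0, 0, 0, 0;
     0, 0, 0, 0, 0, 0, 1, 0, 0, 0, 0, 0, 0, 0, 0, 0, 0, 0, 0, 0, 0, 0;
     0, 0, 0, 0, 0, 0, 0, 1, 0, 0, 0, 0, 0, 0, 0, 0, 0, 0, 0, 0, 0, 0;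
     0, 0, 0, 0, 0, 0, 0, 0, 1, 0, 0, 0, 0, 0, 0, 0, 0, 0, 0, 0, 0, 0;
     0, 0, 0, 0, 0, 0, 0, 0, 0, 1, 0, 0, 0, 0, 0, 0, 0, 0, 0, 0, 0, 0;
     0, 0, 0, 0, 0, 0, 0, 0, 0, 0, 1, 0, 0, 0, 0, 0, 0, 0, 0, 0, 0, 0;
     0, 0, 0, 0, 0, 0, 0, 0, 0, 0, 0, 1, 0, 0, 0, 0, 0, 0, 0, 0, 0, 0;
     0, 0, 0, 0, 0, 0, 0, 0, 0, 0, 0, 0, 1, 0, 0, 0, 0, 0, 0, 0, 0, 0;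
     0, 0, 0, 0, 0, 0, 0, 0, 0, 0, 0, 0, 0, 1, 0, 0, 0, 0, 0, 0, 0, 0]

/-- The embedding of the second copy of `Γ` into the K3 lattice. -/
def secondEmb : Matrix (Fin 22) (Fin 10) ℤ :=
  !![0, 0, 0, 0, 0, 0, 0, 0, 0, 0;
     0, 0, 0, 0, 0, 0, 0, 0, 0, 0;
     0, 0, 0, 0, 0, 0, 0, 0, 0, 0;
     0, 0, 0, 0, 0, 0, 0, 0, 0, 0;
     1, 0, 0, 0, 0, 0, 0, 0, 0, 0;
     0, 1, 0, 0, 0, 0, 0, 0, 0, 0;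
     0, 0, 0, 0, 0, 0, 0, 0, 0, 0;
     0, 0, 0, 0, 0, 0, 0, 0, 0, 0;
     0, 0, 0, 0, 0, 0, 0, 0, 0, 0;
     0, 0, 0, 0, 0, 0, 0, 0, 0, 0;
     0, 0, 0, 0, 0, 0, 0, 0, 0, 0;
     0, 0, 0, 0, 0, 0, 0, 0, 0, 0;
     0, 0, 0, 0, 0, 0, 0, 0, 0, 0;
     0, 0, 0, 0, 0, 0, 0, 0, 0, 0;
     0, 0, 1, 0, 0, 0, 0, 0, 0, 0;
     0, 0, 0, 1, 0, 0, 0, 0, 0, 0;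
     0, 0, 0, 0, 1, 0, 0, 0, 0, 0;
     0, 0, 0, 0, 0, 1, 0, 0, 0, 0;
     0, 0, 0, 0, 0, 0, 1, 0, 0, 0;
     0, 0, 0, 0, 0, 0, 0, 1, 0, 0;
     0, 0, 0, 0, 0, 0, 0, 0, 1, 0;
     0, 0, 0, 0, 0, 0, 0, 0, 0, 1]

section RationalSpace

variable {V : Type*} [AddCommGroup V] [Module ℚ V]

/-- A rational number is integral if it is the cast of an integer. -/
def IsIntCast (q : ℚ) : Prop := q ∈ (Int.castRingHom ℚ).range

theorem IsIntCast.intCast (k : ℤ) : IsIntCast (k : ℚ) := ⟨k, rfl⟩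

/-- Linear automorphisms preserving a bilinear form. -/
def PreservesForm (b : LinearMap.BilinForm ℚ V) (g : V ≃ₗ[ℚ] V) : Prop :=
  ∀ x y, b (g x) (g y) = b x y

theorem PreservesForm.trans {b : LinearMap.BilinForm ℚ V} {g h : V ≃ₗ[ℚ] V}
    (hg : PreservesForm b g) (hh : PreservesForm b h) : PreservesForm b (g.trans h) :=
  fun x y => by simp only [LinearEquiv.trans_apply]; rw [hh, hg]

theorem PreservesForm.symm {b : LinearMap.BilinForm ℚ V} {g : V ≃ₗ[ℚ] V}
    (hg : PreservesForm b g) : PreservesForm b g.symm :=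
  fun x y => by rw [← hg]; simp

/-- Reflections in anisotropic vectors. -/
theorem exists_reflection (b : LinearMap.BilinForm ℚ V) (hs : ∀ x y, b x y = b y x)
    (u : V) (hu : b u u ≠ 0) :
    ∃ g : V ≃ₗ[ℚ] V, PreservesForm b g ∧ ∀ v, g v = v - (2 * b u v / b u u) • u := by
  let s : V →ₗ[ℚ] V := LinearMap.id - ((2 / b u u) • b u).smulRight u
  have hsv : ∀ v, s v = v - (2 * b u v / b u u) • u := by
    intro v
    simp only [s, LinearMap.sub_apply, LinearMap.id_apply, LinearMap.smulRight_apply,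
      LinearMap.smul_apply, smul_eq_mul]
    congr 2
    ring
  have hinv : Function.Involutive s := by
    intro v
    rw [hsv (s v), hsv v]
    have : 2 * b u (v - (2 * b u v / b u u) • u) / b u u = - (2 * b u v / b u u) := by
      simp only [map_sub, map_smul, smul_eq_mul]
      field_simp
      ring
    rw [this]
    module
  refine ⟨LinearEquiv.ofInvolutive s hinv, ?_, fun v => hsv v⟩
  intro x y
  change b (s x) (s y) = b x y
  rw [hsv, hsv]
  simp only [map_sub, map_smul, smul_eq_mul, LinearMap.sub_apply, LinearMap.smul_apply]
  rw [hs x u]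
  field_simp
  ring

theorem exists_preservesForm_apply_eq (b : LinearMap.BilinForm ℚ V) (hs : ∀ x y, b x y = b y x)
    (v w : V) (hvw : b v v = b w w) (hw : b w w ≠ 0) :
    ∃ g : V ≃ₗ[ℚ] V, PreservesForm b g ∧ g v = w ∧
      ∀ y, b v y = 0 → b w y = 0 → g y = y := by
  by_cases h : b (v - w) (v - w) = 0
  · have h2 : b (v + w) (v + w) ≠ 0 := by
      intro h3
      simp only [map_sub, map_add, LinearMap.sub_apply, LinearMap.add_apply] at h h3
      apply hw
      linarith
    obtain ⟨g, hg, hgv⟩ := exists_reflection b hs (v + w) h2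
    obtain ⟨r, hr, hrv⟩ := exists_reflection b hs w hw
    refine ⟨g.trans r, hg.trans hr, ?_, ?_⟩
    · have e1 : g v = -w := by
        have e : 2 * b (v + w) v / b (v + w) (v + w) = 1 := by
          rw [div_eq_one_iff_eq h2]
          simp only [map_add, LinearMap.add_apply, hs w v]
          linarith
        rw [hgv, e]
        module
      simp only [LinearEquiv.trans_apply, e1, hrv]
      have e : 2 * b w (-w) / b w w = -2 := by
        simp only [map_neg]
        field_simp
      rw [e]
      module
    · intro y h4 h5
      have e1 : g y = y := by
        rw [hgv]
        simp [h4, h5]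
      simp only [LinearEquiv.trans_apply, e1, hrv]
      simp [h5]
  · obtain ⟨g, hg, hgv⟩ := exists_reflection b hs (v - w) h
    refine ⟨g, hg, ?_, ?_⟩
    · have e : 2 * b (v - w) v / b (v - w) (v - w) = 1 := by
        rw [div_eq_one_iff_eq h]
        simp only [map_sub, LinearMap.sub_apply, hs w v]
        linarith
      rw [hgv, e]
      module
    · intro y h4 h5
      rw [hgv]
      simp [h4, h5]

/-- Witt's extension theorem for families of pairwise orthogonal anisotropic vectors. -/
theorem exists_preservesForm_extending (b : LinearMap.BilinForm ℚ V)
    (hs : ∀ x y, b x y = b y x) (n : ℕ) (v w : Fin n → V)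
    (hv : ∀ i j, i ≠ j → b (v i) (v j) = 0) (hw : ∀ i j, i ≠ j → b (w i) (w j) = 0)
    (hvw : ∀ i, b (v i) (v i) = b (w i) (w i)) (hne : ∀ i, b (w i) (w i) ≠ 0) :
    ∃ g : V ≃ₗ[ℚ] V, PreservesForm b g ∧ ∀ i, g (v i) = w i := by
  induction n with
  | zero => exact ⟨LinearEquiv.refl ℚ V, fun _ _ => rfl, fun i => i.elim0⟩
  | succ n ih =>
    obtain ⟨g, hg, hgv⟩ := ih (fun i => v i.castSucc) (fun i => w i.castSucc)
      (fun i j hij => hv _ _ (by simpa using hij)) (fun i j hij => hw _ _ (by simpa using hij))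
      (fun i => hvw _) (fun i => hne _)
    obtain ⟨r, hr, hrv, hry⟩ := exists_preservesForm_apply_eq b hs (g (v (Fin.last n)))
      (w (Fin.last n)) (by rw [hg, hvw]) (hne _)
    refine ⟨g.trans r, hg.trans hr, fun i => ?_⟩
    refine Fin.lastCases ?_ (fun i => ?_) i
    · simpa using hrv
    · simp only [LinearEquiv.trans_apply]
      rw [hgv i]
      apply hry
      · rw [← hgv i, hg]
        exact hv _ _ (Fin.castSucc_lt_last i).ne'
      · exact hw _ _ (Fin.castSucc_lt_last i).ne'

/-- Eichler transvections. -/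
theorem exists_transvection (b : LinearMap.BilinForm ℚ V) (hs : ∀ x y, b x y = b y x)
    (e x : V) (he : b e e = 0) (hex : b e x = 0) :
    ∃ g : V ≃ₗ[ℚ] V, PreservesForm b g ∧
      ∀ v, g v = v + b e v • x - (b x v + b x x / 2 * b e v) • e := by
  let s : V → V →ₗ[ℚ] V := fun x =>
    LinearMap.id + (b e).smulRight x - (b x + (b x x / 2) • b e).smulRight e
  have hsv : ∀ x v, s x v = v + b e v • x - (b x v + b x x / 2 * b e v) • e := by
    intro x v
    simp [s]
  have hinv : ∀ x, b e x = 0 → ∀ v, s (-x) (s x v) = v := by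
    intro x hx v
    rw [hsv (-x), hsv x]
    simp only [map_sub, map_add, map_smul, smul_eq_mul, map_neg, LinearMap.neg_apply, he, hx,
      hs x e]
    module
  refine ⟨LinearEquiv.ofLinearMap (s x) (s (-x)) ?_ ?_, ?_, fun v => hsv x v⟩
  · ext v
    have := hinv (-x) (by simp [hex]) v
    rw [neg_neg] at this
    simpa using this
  · ext v
    simpa using hinv x hex v
  · intro v w
    change b (s x v) (s x w) = b v w
    rw [hsv, hsv]
    simp only [map_sub, map_add, map_smul, smul_eq_mul, LinearMap.sub_apply, LinearMap.add_apply,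
      LinearMap.smul_apply, he, hex, hs x e, hs v e, hs v x]
    ring

/-- Rescaling of a hyperbolic plane. -/
theorem exists_hyperbolic_scaling (b : LinearMap.BilinForm ℚ V) (hs : ∀ x y, b x y = b y x)
    (e f : V) (he : b e e = 0) (hf : b f f = 0) (hef : b e f = 1) (d : ℚ) (hd : d ≠ 0) :
    ∃ g : V ≃ₗ[ℚ] V, PreservesForm b g ∧
      ∀ v, g v = v + ((d - 1) * b f v) • e + ((d⁻¹ - 1) * b e v) • f := by
  let s : ℚ → V →ₗ[ℚ] V := fun d =>
    LinearMap.id + ((d - 1) • b f).smulRight e + ((d⁻¹ - 1) • b e).smulRight f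
  have hsv : ∀ d v, s d v = v + ((d - 1) * b f v) • e + ((d⁻¹ - 1) * b e v) • f := by
    intro x v
    simp [s]
  have hfe : b f e = 1 := by rw [hs, hef]
  have hinv : ∀ d : ℚ, d ≠ 0 → ∀ v, s d⁻¹ (s d v) = v := by
    intro d hd v
    rw [hsv d⁻¹, hsv d]
    simp only [map_add, map_smul, smul_eq_mul, he, hf, hef, hfe, inv_inv]
    match_scalars
    · ring
    · field_simp
      ring
    · field_simp
      ring
  refine ⟨LinearEquiv.ofLinearMap (s d) (s d⁻¹) ?_ ?_, ?_, fun v => hsv d v⟩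
  · ext v
    have := hinv d⁻¹ (inv_ne_zero hd) v
    rw [inv_inv] at this
    simpa using this
  · ext v
    simpa using hinv d hd v
  · intro v w
    change b (s d v) (s d w) = b v w
    rw [hsv, hsv]
    simp only [map_add, map_smul, smul_eq_mul, LinearMap.add_apply,
      LinearMap.smul_apply, he, hf, hef, hfe, hs v e, hs v f]
    field_simp
    ring

/-- A full subgroup of a rational quadratic space which is even and equal to its own dual. -/
structure IsEvenUnimodular (b : LinearMap.BilinForm ℚ V) (N : AddSubgroup V) : Prop where
  half_norm : ∀ x ∈ N, IsIntCast (b x x / 2)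
  mem_iff : ∀ x, x ∈ N ↔ ∀ y ∈ N, IsIntCast (b x y)
  full : ∀ x, ∃ d : ℤ, d ≠ 0 ∧ (d : ℚ) • x ∈ N

theorem AddSubgroup.smul_mem_of_isIntCast (N : AddSubgroup V) {q : ℚ} (hq : IsIntCast q) {x : V}
    (hx : x ∈ N) : q • x ∈ N := by
  obtain ⟨k, rfl⟩ := hq
  rw [eq_intCast, Int.cast_smul_eq_zsmul]
  exact N.zsmul_mem hx k

theorem IsEvenUnimodular.integral {b : LinearMap.BilinForm ℚ V} {N : AddSubgroup V}
    (hN : IsEvenUnimodular b N) {x y : V} (hx : x ∈ N) (hy : y ∈ N) : IsIntCast (b x y) :=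
  (hN.mem_iff x).1 hx y hy

theorem IsEvenUnimodular.comap {b : LinearMap.BilinForm ℚ V} {N : AddSubgroup V}
    (hN : IsEvenUnimodular b N) {g : V ≃ₗ[ℚ] V} (hg : PreservesForm b g) :
    IsEvenUnimodular b (N.comap (g : V →+ V)) where
  half_norm x hx := by
    rw [← hg]
    exact hN.half_norm _ hx
  mem_iff x := by
    change g x ∈ N ↔ _
    rw [hN.mem_iff]
    constructor
    · intro h y hy
      rw [← hg]
      exact h _ hy
    · intro h y hy
      have := h (g.symm y) (by change g (g.symm y) ∈ N; simpa using hy)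
      rw [← hg] at this
      simpa using this
  full x := by
    obtain ⟨d, hd, h⟩ := hN.full (g x)
    refine ⟨d, hd, ?_⟩
    change g _ ∈ N
    simpa using h

theorem IsEvenUnimodular.eq_of_le {b : LinearMap.BilinForm ℚ V} {N L : AddSubgroup V}
    (hN : IsEvenUnimodular b N) (hL : IsEvenUnimodular b L) (h : L ≤ N) : L = N := by
  refine le_antisymm h fun x hx => ?_
  rw [hL.mem_iff]
  exact fun y hy => hN.integral hx (h hy)

/-- Every vector outside the radical has a multiple which is primitive in a given unimodular
lattice. -/
theorem IsEvenUnimodular.exists_primitive_smul {b : LinearMap.BilinForm ℚ V} {N : AddSubgroup V}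
    (hN : IsEvenUnimodular b N) (x x' : V) (hx : b x x' ≠ 0) :
    ∃ c : ℚ, c ≠ 0 ∧ c • x ∈ N ∧ ∃ z ∈ N, b (c • x) z = 1 := by
  obtain ⟨d, hd, hdx⟩ := hN.full x
  obtain ⟨d', hd', hdx'⟩ := hN.full x'
  let I : Ideal ℤ :=
    { carrier := {k | ∃ y ∈ N, b ((d : ℚ) • x) y = k}
      add_mem' := by
        rintro k l ⟨y, hy, hk⟩ ⟨z, hz, hl⟩
        exact ⟨y + z, N.add_mem hy hz, by rw [map_add, hk, hl]; push_cast; rfl⟩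
      zero_mem' := ⟨0, N.zero_mem, by simp⟩
      smul_mem' := by
        rintro c k ⟨y, hy, hk⟩
        refine ⟨(c : ℚ) • y, N.smul_mem_of_isIntCast (.intCast c) hy, ?_⟩
        rw [map_smul, hk]
        simp }
  obtain ⟨m, hm⟩ := (IsPrincipalIdealRing.principal I).principal
  have hmem : ∀ k : ℤ, (∃ y ∈ N, b ((d : ℚ) • x) y = k) → m ∣ k := by
    intro k hk
    have : k ∈ I := hk
    rw [hm] at this
    exact Ideal.mem_span_singleton.1 this
  obtain ⟨y0, hy0, hmy0⟩ : m ∈ I := by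
    rw [hm]
    exact Submodule.mem_span_singleton_self m
  have hm0 : (m : ℚ) ≠ 0 := by
    intro h0
    obtain ⟨k, hk⟩ := hN.integral hdx hdx'
    have hk' : b ((d : ℚ) • x) ((d' : ℚ) • x') = (k : ℚ) := hk.symm
    have h1 := hmem k ⟨_, hdx', hk'⟩
    have h2 : m = 0 := by exact_mod_cast h0
    rw [h2, zero_dvd_iff] at h1
    rw [h1] at hk'
    simp only [map_smul, LinearMap.smul_apply, smul_eq_mul, Int.cast_zero, mul_eq_zero,
      Int.cast_eq_zero] at hk'
    tauto
  refine ⟨d / m, div_ne_zero (by exact_mod_cast hd) hm0, ?_, y0, hy0, ?_⟩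
  · rw [hN.mem_iff]
    intro y hy
    obtain ⟨k, hk⟩ := hN.integral hdx hy
    have hk' : b ((d : ℚ) • x) y = (k : ℚ) := hk.symm
    obtain ⟨l, rfl⟩ := hmem k ⟨y, hy, hk'⟩
    refine ⟨l, ?_⟩
    simp only [map_smul, LinearMap.smul_apply, smul_eq_mul] at hk' ⊢
    push_cast at hk'
    rw [div_mul_eq_mul_div, hk', eq_intCast]
    field_simp
  · simp only [map_smul, LinearMap.smul_apply, smul_eq_mul] at hmy0 ⊢
    rw [div_mul_eq_mul_div, hmy0]
    field_simp

theorem IsEvenUnimodular.exists_isotropic_dual {b : LinearMap.BilinForm ℚ V}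
    (hs : ∀ x y, b x y = b y x) {N : AddSubgroup V} (hN : IsEvenUnimodular b N) {w z : V}
    (hw : w ∈ N) (hww : b w w = 0) (hz : z ∈ N) (hwz : b w z = 1) :
    ∃ z' ∈ N, b z' z' = 0 ∧ b w z' = 1 := by
  refine ⟨z - (b z z / 2) • w,
    N.sub_mem hz (N.smul_mem_of_isIntCast (hN.half_norm z hz) hw), ?_, ?_⟩
  · simp only [map_sub, map_smul, smul_eq_mul, LinearMap.sub_apply, LinearMap.smul_apply, hww,
      hwz, hs z w]
    ring
  · simp only [map_sub, map_smul, smul_eq_mul, hww, hwz]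
    ring

/-- An isometry moving one hyperbolic pair `(c • e, z)` to another one `(e, f)`, which acts on
the orthogonal complement of `e` trivially modulo `e`. -/
theorem exists_preservesForm_hyperbolic (b : LinearMap.BilinForm ℚ V)
    (hs : ∀ x y, b x y = b y x) (e f z : V) (he : b e e = 0) (hf : b f f = 0) (hef : b e f = 1)
    (hz : b z z = 0) (c : ℚ) (hc : c ≠ 0) (hez : b (c • e) z = 1) :
    ∃ g : V ≃ₗ[ℚ] V, PreservesForm b g ∧ g (c • e) = e ∧ g z = f ∧
      ∀ v, b e v = 0 → ∃ q : ℚ, g v = v + q • e := by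
  have hez' : b e z = c⁻¹ := by
    simp only [map_smul, LinearMap.smul_apply, smul_eq_mul] at hez
    field_simp
    linarith
  have hfe : b f e = 1 := by rw [hs, hef]
  set y := (-c) • (z - b e z • f - b f z • e) with hy
  have hey : b e y = 0 := by
    simp only [hy, map_sub, map_smul, smul_eq_mul, he, hef]
    ring
  obtain ⟨t, ht, htv⟩ := exists_transvection b hs e y he hey
  obtain ⟨s, hs', hsv⟩ := exists_hyperbolic_scaling b hs e f he hf hef c⁻¹ (inv_ne_zero hc)
  have hte : t e = e := by
    rw [htv, he, hs y e, hey]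
    simp
  have hse : s e = c⁻¹ • e := by
    rw [hsv, he, hfe]
    module
  have hsf : s f = c • f := by
    rw [hsv, hf, hef, inv_inv]
    module
  have htz : t z = c⁻¹ • f := by
    have h1 : ∃ r : ℚ, t z = c⁻¹ • f + r • e := by
      refine ⟨b f z - (b y z + b y y / 2 * c⁻¹), ?_⟩
      rw [htv, hez', hy, hez', smul_smul, mul_neg, inv_mul_cancel₀ hc]
      module
    obtain ⟨r, hr⟩ := h1
    have h2 : b (t z) (t z) = 0 := by rw [ht, hz]
    rw [hr] at h2
    simp only [map_add, map_smul, smul_eq_mul, LinearMap.add_apply, LinearMap.smul_apply, hf,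
      he, hef, hfe] at h2
    have h3 : r = 0 := by
      have h4 : 2 * c⁻¹ * r = 0 := by linarith
      simpa [hc] using h4
    rw [hr, h3]
    simp
  refine ⟨t.trans s, ht.trans hs', ?_, ?_, ?_⟩
  · simp only [LinearEquiv.trans_apply, map_smul, hte, hse, smul_smul, mul_inv_cancel₀ hc,
      one_smul]
  · simp only [LinearEquiv.trans_apply, htz, map_smul, hsf, smul_smul, inv_mul_cancel₀ hc,
      one_smul]
  · intro v hv
    refine ⟨(-(b y v)) * c⁻¹ + (c⁻¹ - 1) * b f v, ?_⟩
    simp only [LinearEquiv.trans_apply, htv, hv, map_add, map_sub, map_smul, hse]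
    rw [hsv v, hv]
    module

/-- Passing from `N = ⟨e, f⟩ ⊕ K` to `⟨e, f⟩ ⊕ K'`, where `K'` is the neighbour of `K` given
by `x`, does not change the isometry class. -/
theorem IsEvenUnimodular.exists_neighbour {b : LinearMap.BilinForm ℚ V}
    (hs : ∀ x y, b x y = b y x) {N : AddSubgroup V} (hN : IsEvenUnimodular b N) (e f x : V)
    (he : b e e = 0) (hf : b f f = 0) (hef : b e f = 1) (heN : e ∈ N) (hfN : f ∈ N)
    (hex : b e x = 0) (hfx : b f x = 0) (hx : IsIntCast (b x x / 2)) :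
    ∃ g : V ≃ₗ[ℚ] V, PreservesForm b g ∧ g e ∈ N ∧ g f ∈ N ∧ g x ∈ N ∧
      ∀ y ∈ N, b e y = 0 → b f y = 0 → IsIntCast (b x y) → g y ∈ N := by
  have hfe : b f e = 1 := by rw [hs, hef]
  have hxe : b x e = 0 := by rw [hs, hex]
  have hxf : b x f = 0 := by rw [hs, hfx]
  set e' := e + x - (b x x / 2) • f with he'
  have he'f : b e' f = 1 := by simp [he', hf, hef, hxf]
  have he'e' : b e' e' = 0 := by
    simp only [he', map_add, map_sub, map_smul, smul_eq_mul, LinearMap.add_apply,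
      LinearMap.sub_apply, LinearMap.smul_apply, he, hf, hef, hfe, hex, hxe, hfx, hxf]
    ring
  obtain ⟨c, hc, hwN, z0, hz0N, hwz0⟩ := hN.exists_primitive_smul e' f (by rw [he'f]; simp)
  obtain ⟨z, hzN, hzz, hwz⟩ := hN.exists_isotropic_dual hs hwN (by simp [he'e']) hz0N hwz0
  obtain ⟨a, ha, hav⟩ := exists_transvection b hs f (-x) hf (by simp [hfx])
  have hae' : a e' = e := by
    rw [hav, he']
    simp only [map_add, map_sub, map_smul, smul_eq_mul, map_neg, LinearMap.neg_apply, hf, hfe,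
      hfx, hxe, hxf]
    module
  obtain ⟨r, hr, hre, hrz, hrv⟩ := exists_preservesForm_hyperbolic b hs e f (a z) he hf hef
    (by rw [ha, hzz]) c hc (by rw [← hae', ← map_smul, ha, hwz])
  have key : ∀ n ∈ N, ∀ y : V, b e y = 0 → b f y = 0 → (∃ q : ℚ, a n = y + q • e) →
      (a.trans r).symm y ∈ N := by
    rintro n hn y hey hfy ⟨q, hq⟩
    obtain ⟨q', hq'⟩ := hrv (a n) (by rw [hq, map_add, map_smul, he, hey]; simp)
    have h1 : (a.trans r) n = y + (q + q') • e := by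
      rw [LinearEquiv.trans_apply, hq', hq]
      module
    have h2 : (a.trans r) (c • e') = e := by
      rw [LinearEquiv.trans_apply, map_smul, hae', hre]
    have h3 : (a.trans r).symm y = n - (q + q') • (c • e') := by
      rw [LinearEquiv.symm_apply_eq, map_sub, map_smul, h1, h2]
      module
    have h4 : b n z = q + q' := by
      rw [← (ha.trans hr) n z, h1, LinearEquiv.trans_apply, hrz, map_add, map_smul]
      simp [hef, hs y f, hfy]
    rw [h3]
    refine N.sub_mem hn (N.smul_mem_of_isIntCast ?_ hwN)
    rw [← h4]
    exact hN.integral hn hzN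
  refine ⟨(a.trans r).symm, (ha.trans hr).symm, ?_, ?_, ?_, ?_⟩
  · have : (a.trans r).symm e = c • e' := by
      rw [LinearEquiv.symm_apply_eq, LinearEquiv.trans_apply, map_smul, hae', hre]
    rw [this]
    exact hwN
  · have : (a.trans r).symm f = z := by
      rw [LinearEquiv.symm_apply_eq, LinearEquiv.trans_apply, hrz]
    rw [this]
    exact hzN
  · refine key (-e - (b x x / 2) • f)
      (N.sub_mem (N.neg_mem heN) (N.smul_mem_of_isIntCast hx hfN)) x hex hfx ⟨-1, ?_⟩
    rw [hav]
    simp only [map_sub, map_smul, smul_eq_mul, map_neg, LinearMap.neg_apply, hf, hfe,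
      hxe, hxf]
    module
  · intro y hy hey hfy hxy
    refine key (y - b x y • f) (N.sub_mem hy (N.smul_mem_of_isIntCast hxy hfN)) y hey hfy ⟨0, ?_⟩
    rw [hav]
    simp only [map_sub, map_smul, smul_eq_mul, map_neg, LinearMap.neg_apply, hf, hxf, hfy]
    module

/-- In a space containing a hyperbolic plane `⟨e, f⟩`, an even unimodular lattice through `e` and
`f` can be moved so that it contains a given even system of vectors orthogonal to `e` and `f`. -/
theorem IsEvenUnimodular.exists_preservesForm_mem {b : LinearMap.BilinForm ℚ V}
    (hs : ∀ x y, b x y = b y x) {N : AddSubgroup V} (hN : IsEvenUnimodular b N) (e f : V)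
    (he : b e e = 0) (hf : b f f = 0) (hef : b e f = 1) (heN : e ∈ N) (hfN : f ∈ N)
    (l : List V) (hel : ∀ x ∈ l, b e x = 0) (hfl : ∀ x ∈ l, b f x = 0)
    (hl : ∀ x ∈ l, IsIntCast (b x x / 2)) (hll : ∀ x ∈ l, ∀ y ∈ l, IsIntCast (b x y)) :
    ∃ g : V ≃ₗ[ℚ] V, PreservesForm b g ∧ g e ∈ N ∧ g f ∈ N ∧ ∀ x ∈ l, g x ∈ N := by
  induction l with
  | nil => exact ⟨LinearEquiv.refl ℚ V, fun _ _ => rfl, heN, hfN, by simp⟩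
  | cons x l ih =>
    obtain ⟨g, hg, hge, hgf, hgl⟩ := ih (fun y hy => hel y (.tail _ hy))
      (fun y hy => hfl y (.tail _ hy)) (fun y hy => hl y (.tail _ hy))
      (fun y hy z hz => hll y (.tail _ hy) z (.tail _ hz))
    obtain ⟨h, hh, hhe, hhf, hhx, hhy⟩ := (hN.comap hg).exists_neighbour hs e f x he hf hef
      hge hgf (hel x (.head _)) (hfl x (.head _)) (hl x (.head _))
    refine ⟨h.trans g, hh.trans hg, hhe, hhf, fun y hy => ?_⟩
    rcases List.mem_cons.1 hy with rfl | hy'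
    · exact hhx
    · exact hhy y (hgl y hy') (hel y hy) (hfl y hy) (hll x (.head _) y hy)

end RationalSpace

section IntegralForms

variable {l m n : ℕ}

/-- Coordinatewise cast of integral vectors to a ring. -/
def castVec (R : Type*) [CommRing R] : (Fin n → ℤ) →+ (Fin n → R) :=
  (Int.castAddHom R).compLeft (Fin n)

@[simp] theorem castVec_apply (R : Type*) [CommRing R] (x : Fin n → ℤ) (i : Fin n) :
    castVec R x i = (x i : R) := rfl

theorem castVec_zsmul (R : Type*) [CommRing R] (k : ℤ) (x : Fin n → ℤ) :
    castVec R (k • x) = (k : R) • castVec R x := by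
  ext i; simp

/-- The bilinear form over `R` given by an integral Gram matrix. -/
def castForm (R : Type*) [CommRing R] (A : Matrix (Fin n) (Fin n) ℤ) :
    LinearMap.BilinForm R (Fin n → R) :=
  Matrix.toBilin' (A.map Int.cast)

/-- The linear map over `R` given by an integral matrix. -/
def castLin (R : Type*) [CommRing R] (A : Matrix (Fin m) (Fin n) ℤ) :
    (Fin n → R) →ₗ[R] (Fin m → R) :=
  (A.map Int.cast : Matrix (Fin m) (Fin n) R).mulVecLin

theorem castLin_castVec (R : Type*) [CommRing R] (A : Matrix (Fin m) (Fin n) ℤ) (x : Fin n → ℤ) :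
    castLin R A (castVec R x) = castVec R (A *ᵥ x) := by
  ext i
  simp [castLin, Matrix.mulVec, dotProduct]

theorem castForm_apply (R : Type*) [CommRing R] (A : Matrix (Fin n) (Fin n) ℤ) (x y : Fin n → R) :
    castForm R A x y = x ⬝ᵥ (castLin R A y) := by
  simp [castForm, castLin, Matrix.toBilin'_apply']

theorem castForm_castVec (R : Type*) [CommRing R] (A : Matrix (Fin n) (Fin n) ℤ) (x y : Fin n → ℤ) :
    castForm R A (castVec R x) (castVec R y) = ((x ⬝ᵥ (A *ᵥ y) : ℤ) : R) := by
  rw [castForm_apply, castLin_castVec]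
  simp [dotProduct]

theorem castForm_comm (R : Type*) [CommRing R] {A : Matrix (Fin n) (Fin n) ℤ} (hA : A.IsSymm)
    (x y : Fin n → R) :
    castForm R A x y = castForm R A y x := by
  have h : (A.map (Int.cast : ℤ → R)).IsSymm := hA.map _
  rw [castForm_apply, castForm_apply, castLin, Matrix.mulVecLin_apply, Matrix.mulVecLin_apply,
    Matrix.dotProduct_mulVec, ← Matrix.mulVec_transpose, h.eq, dotProduct_comm]

theorem castLin_castLin (R : Type*) [CommRing R]
    (A : Matrix (Fin l) (Fin m) ℤ) (B : Matrix (Fin m) (Fin n) ℤ) (x : Fin n → R) :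
    castLin R A (castLin R B x) = castLin R (A * B) x := by
  have h : (A * B).map (Int.cast : ℤ → R) =
      (A.map Int.cast : Matrix _ _ R) * (B.map Int.cast : Matrix _ _ R) :=
    Matrix.map_mul (f := Int.castRingHom R)
  rw [castLin, castLin, castLin, h, Matrix.mulVecLin_mul, LinearMap.comp_apply]

theorem castForm_castLin (R : Type*) [CommRing R]
    (A : Matrix (Fin l) (Fin l) ℤ) (B : Matrix (Fin l) (Fin m) ℤ) (C : Matrix (Fin l) (Fin n) ℤ)
    (x : Fin m → R) (y : Fin n → R) :
    castForm R A (castLin R B x) (castLin R C y) = x ⬝ᵥ castLin R (Bᵀ * A * C) y := by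
  rw [castForm_apply, castLin_castLin, Matrix.mul_assoc, ← castLin_castLin R Bᵀ]
  simp only [castLin, Matrix.mulVecLin_apply]
  rw [Matrix.transpose_map, Matrix.dotProduct_mulVec _ (_ᵀ), Matrix.vecMul_transpose]

theorem castLin_one (R : Type*) [CommRing R] (x : Fin n → R) :
    castLin R (1 : Matrix (Fin n) (Fin n) ℤ) x = x := by
  simp [castLin]

theorem castLin_add (R : Type*) [CommRing R] (A B : Matrix (Fin m) (Fin n) ℤ) (x : Fin n → R) :
    castLin R (A + B) x = castLin R A x + castLin R B x := by
  simp [castLin, Matrix.map_add]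

theorem castLin_zsmul (R : Type*) [CommRing R] (k : ℤ) (A : Matrix (Fin m) (Fin n) ℤ)
    (x : Fin n → R) :
    castLin R (k • A) x = (k : R) • castLin R A x := by
  ext i
  simp [castLin, Matrix.mulVec, dotProduct, Finset.mul_sum, mul_assoc]

theorem castLin_zero (R : Type*) [CommRing R] (x : Fin n → R) :
    castLin R (0 : Matrix (Fin m) (Fin n) ℤ) x = 0 := by
  simp [castLin]

/-- The standard lattice of integral vectors. -/
def stdLattice (n : ℕ) : AddSubgroup (Fin n → ℚ) := (castVec ℚ).range

theorem castVec_mem_stdLattice (x : Fin n → ℤ) : castVec ℚ x ∈ stdLattice n := ⟨x, rfl⟩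

theorem castVec_rat_injective : Function.Injective (castVec ℚ : (Fin n → ℤ) → (Fin n → ℚ)) := by
  intro x y h
  ext i
  have := congrFun h i
  simpa using this

theorem exists_smul_mem_stdLattice (x : Fin n → ℚ) :
    ∃ d : ℤ, d ≠ 0 ∧ (d : ℚ) • x ∈ stdLattice n := by
  obtain ⟨d, hd⟩ := IsLocalization.exist_integer_multiples_of_finite (nonZeroDivisors ℤ) x
  choose y hy using hd
  refine ⟨d, nonZeroDivisors.ne_zero d.2, y, ?_⟩
  ext i
  have := hy i
  simpa [Algebra.smul_def] using this

theorem dotProduct_mulVec_self_even {A L : Matrix (Fin n) (Fin n) ℤ} (h : A = L + Lᵀ)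
    (x : Fin n → ℤ) :
    x ⬝ᵥ (A *ᵥ x) = 2 * (x ⬝ᵥ (L *ᵥ x)) := by
  rw [h, Matrix.add_mulVec, dotProduct_add, Matrix.mulVec_transpose, dotProduct_comm x (x ᵥ* L),
    ← Matrix.dotProduct_mulVec]
  ring

theorem isEvenUnimodular_stdLattice {A A' L : Matrix (Fin n) (Fin n) ℤ} (hL : A = L + Lᵀ)
    (hA : A * A' = 1) :
    IsEvenUnimodular (castForm ℚ A) (stdLattice n) where
  half_norm := by
    rintro _ ⟨x, rfl⟩
    rw [castForm_castVec, dotProduct_mulVec_self_even hL]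
    refine ⟨x ⬝ᵥ (L *ᵥ x), ?_⟩
    simp
  mem_iff := by
    intro x
    refine ⟨?_, fun h => ?_⟩
    · rintro ⟨x, rfl⟩ _ ⟨y, rfl⟩
      rw [castForm_castVec]
      exact .intCast _
    · have h1 : ∀ i, IsIntCast (x i) := by
        intro i
        have := h (castVec ℚ (A' *ᵥ Pi.single i 1)) (castVec_mem_stdLattice _)
        rw [castForm_apply, castLin_castVec, Matrix.mulVec_mulVec, hA, Matrix.one_mulVec] at this
        have h2 : castVec ℚ (Pi.single i (1 : ℤ)) = Pi.single i (1 : ℚ) := by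
          ext j; by_cases hj : j = i
          · subst hj; simp
          · simp [hj]
        rw [h2] at this
        simpa using this
      choose y hy using h1
      exact ⟨y, by ext i; exact hy i⟩
  full := exists_smul_mem_stdLattice

end IntegralForms

section IntegralPairing

variable {n : ℕ}

/-- The integral bilinear form given by a Gram matrix. -/
def intForm (A : Matrix (Fin n) (Fin n) ℤ) : LinearMap.BilinForm ℤ (Fin n → ℤ) :=
  Matrix.toBilin' A

theorem intForm_apply (A : Matrix (Fin n) (Fin n) ℤ) (x y : Fin n → ℤ) :
    intForm A x y = x ⬝ᵥ (A *ᵥ y) :=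
  Matrix.toBilin'_apply' A x y

theorem castForm_castVec_eq_intForm (R : Type*) [CommRing R] (A : Matrix (Fin n) (Fin n) ℤ)
    (x y : Fin n → ℤ) : castForm R A (castVec R x) (castVec R y) = (intForm A x y : R) := by
  rw [castForm_castVec, intForm_apply]

theorem intForm_comm {A : Matrix (Fin n) (Fin n) ℤ} (hA : A.IsSymm) (x y : Fin n → ℤ) :
    intForm A x y = intForm A y x := by
  rw [intForm_apply, intForm_apply, Matrix.dotProduct_mulVec, ← Matrix.mulVec_transpose, hA.eq,
    dotProduct_comm]

theorem exists_intForm_eq {A A' : Matrix (Fin n) (Fin n) ℤ} (hA : A * A' = 1)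
    (φ : (Fin n → ℤ) →ₗ[ℤ] ℤ) : ∃ x, ∀ y, intForm A x y = φ y := by
  refine ⟨(fun i => φ fun j => if i = j then 1 else 0) ᵥ* A', fun y => ?_⟩
  rw [intForm_apply, Matrix.dotProduct_mulVec, Matrix.vecMul_vecMul, mul_eq_one_comm.mp hA,
    Matrix.vecMul_one, LinearMap.pi_apply_eq_sum_univ φ y]
  simp [dotProduct, mul_comm]

theorem castForm_nondegenerate {A A' : Matrix (Fin n) (Fin n) ℤ} (hA : A * A' = 1)
    (K : Type*) [Field K] : (castForm K A).Nondegenerate := by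
  rw [castForm, LinearMap.BilinForm.nondegenerate_toBilin'_iff_det_ne_zero]
  have h : (A.map (Int.cast : ℤ → K)).det = ((A.det : ℤ) : K) :=
    ((Int.castRingHom K).map_det A).symm
  have h2 : A.det * A'.det = 1 := by rw [← Matrix.det_mul, hA, Matrix.det_one]
  intro h0
  have h3 := congrArg (Int.cast : ℤ → K) h2
  rw [Int.cast_mul, Int.cast_one] at h3
  rw [← h, h0, zero_mul] at h3
  exact zero_ne_one h3

theorem castVec_zmod_two_surjective : Function.Surjective (castVec (n := n) (ZMod 2)) := by
  intro x
  choose y hy using fun i => ZMod.intCast_surjective (x i)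
  exact ⟨y, funext hy⟩

theorem castVec_zmod_two_eq_zero {x : Fin n → ℤ} (h : castVec (ZMod 2) x = 0) :
    ∃ y : Fin n → ℤ, x = (2 : ℤ) • y := by
  have h1 : ∀ i, (2 : ℤ) ∣ x i := fun i =>
    (ZMod.intCast_zmod_eq_zero_iff_dvd (x i) 2).mp (congrFun h i)
  choose y hy using h1
  exact ⟨y, funext fun i => by simpa using hy i⟩

end IntegralPairing

theorem gramK3_isSymm : gramK3.IsSymm := by unfold Matrix.IsSymm; decide +kernel

theorem gramGamma_isSymm : gramGamma.IsSymm := by unfold Matrix.IsSymm; decide +kernel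

theorem gramGamma2_eq : gramGamma2 = (2 : ℤ) • gramGamma := by decide +kernel

theorem gramGamma_mul_inv : gramGamma * gramGammaInv = 1 := by decide +kernel

theorem gramK3_mul_inv : gramK3 * gramK3Inv = 1 := by decide +kernel

theorem exists_gramK3_eq_add_transpose : ∃ L, gramK3 = L + Lᵀ :=
  ⟨Matrix.of fun i j => if i < j then gramK3 i j else if i = j then gramK3 i i / 2 else 0,
    by decide +kernel⟩

theorem exists_gramGamma_eq_add_transpose : ∃ L, gramGamma = L + Lᵀ :=
  ⟨Matrix.of fun i j => if i < j then gramGamma i j else if i = j then gramGamma i i / 2 else 0,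
    by decide +kernel⟩

theorem exists_intForm_gramK3_self (x : Fin 22 → ℤ) : ∃ k, intForm gramK3 x x = 2 * k := by
  obtain ⟨L, hL⟩ := exists_gramK3_eq_add_transpose
  exact ⟨_, (intForm_apply _ _ _).trans (dotProduct_mulVec_self_even hL x)⟩

theorem exists_intForm_gramGamma_self (x : Fin 10 → ℤ) : ∃ k, intForm gramGamma x x = 2 * k := by
  obtain ⟨L, hL⟩ := exists_gramGamma_eq_add_transpose
  exact ⟨_, (intForm_apply _ _ _).trans (dotProduct_mulVec_self_even hL x)⟩

/-- A split embedding of `Γ(2)` into the K3 lattice. -/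
structure IsSplitEmbedding (f : (Fin 10 → ℤ) →ₗ[ℤ] (Fin 22 → ℤ)) : Prop where
  form : ∀ u v, intForm gramK3 (f u) (f v) = 2 * intForm gramGamma u v
  split : ∃ r : (Fin 22 → ℤ) →ₗ[ℤ] (Fin 10 → ℤ), r ∘ₗ f = LinearMap.id

theorem isSplitEmbedding_of_primitive (f : (Fin 10 → ℤ) →ₗ[ℤ] (Fin 22 → ℤ))
    (hinj : Function.Injective f)
    (hform : ∀ u v : Fin 10 → ℤ, bK3 (f u) (f v) = bGamma2 u v)
    (hprim : ∀ (n : ℤ) (x : (Fin 22 → ℤ) ⧸ LinearMap.range f), n • x = 0 → n = 0 ∨ x = 0) :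
    IsSplitEmbedding f where
  form u v := by
    rw [intForm_apply, intForm_apply]
    have h := hform u v
    rw [bK3, bGamma2, gramGamma2_eq] at h
    rw [h, Matrix.smul_mulVec, dotProduct_smul, smul_eq_mul]
  split := by
    have : Module.IsTorsionFree ℤ ((Fin 22 → ℤ) ⧸ LinearMap.range f) := by
      refine Module.isTorsionFree_iff_smul_eq_zero.mpr fun n x => hprim n x
    have : Module.Free ℤ ((Fin 22 → ℤ) ⧸ LinearMap.range f) :=
      Module.free_of_finite_type_torsion_free'
    obtain ⟨s, hs⟩ := LinearMap.exists_rightInverse_of_surjective (LinearMap.range f).mkQ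
      (Submodule.range_mkQ _)
    let p : (Fin 22 → ℤ) →ₗ[ℤ] LinearMap.range f :=
      (LinearMap.id - s ∘ₗ (LinearMap.range f).mkQ).codRestrict _ fun x => by
        refine (Submodule.Quotient.mk_eq_zero _).mp ?_
        rw [← Submodule.mkQ_apply]
        have := LinearMap.congr_fun hs ((LinearMap.range f).mkQ x)
        simp only [LinearMap.comp_apply, LinearMap.id_apply] at this
        rw [LinearMap.sub_apply, map_sub, LinearMap.comp_apply, this, LinearMap.id_apply, sub_self]
    refine ⟨(LinearEquiv.ofInjective f hinj).symm.toLinearMap ∘ₗ p, LinearMap.ext fun u => ?_⟩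
    simp only [LinearMap.comp_apply, LinearMap.id_apply, LinearEquiv.coe_coe]
    rw [LinearEquiv.symm_apply_eq]
    ext1
    have h0 : (LinearMap.range f).mkQ (f u) = 0 := by
      simp
    simp [p, -Submodule.mkQ_apply, h0]

/-- The reduction modulo two of the image of an embedding. -/
def rangeModTwo (f : (Fin 10 → ℤ) →ₗ[ℤ] (Fin 22 → ℤ)) :
    Submodule (ZMod 2) (Fin 22 → ZMod 2) :=
  LinearMap.range (castLin (ZMod 2) (LinearMap.toMatrix' f))

theorem castLin_toMatrix' (R : Type*) [CommRing R] {m n : ℕ}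
    (f : (Fin m → ℤ) →ₗ[ℤ] (Fin n → ℤ)) (u : Fin m → ℤ) :
    castLin R (LinearMap.toMatrix' f) (castVec R u) = castVec R (f u) := by
  rw [castLin_castVec, LinearMap.toMatrix'_mulVec]

theorem mem_rangeModTwo {f : (Fin 10 → ℤ) →ₗ[ℤ] (Fin 22 → ℤ)} {x : Fin 22 → ZMod 2} :
    x ∈ rangeModTwo f ↔ ∃ u, castVec (ZMod 2) (f u) = x := by
  constructor
  · rintro ⟨u, rfl⟩
    obtain ⟨u, rfl⟩ := castVec_zmod_two_surjective u
    exact ⟨u, (castLin_toMatrix' _ f u).symm⟩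
  · rintro ⟨u, rfl⟩
    exact ⟨castVec _ u, castLin_toMatrix' _ f u⟩

namespace IsSplitEmbedding

variable {f : (Fin 10 → ℤ) →ₗ[ℤ] (Fin 22 → ℤ)}

theorem exists_dual (hf : IsSplitEmbedding f) (φ : (Fin 10 → ℤ) →ₗ[ℤ] ℤ) :
    ∃ x, ∀ u, intForm gramK3 x (f u) = φ u := by
  obtain ⟨r, hr⟩ := hf.split
  obtain ⟨x, hx⟩ := exists_intForm_eq gramK3_mul_inv (φ ∘ₗ r)
  refine ⟨x, fun u => ?_⟩
  rw [hx, LinearMap.comp_apply, ← LinearMap.comp_apply r f, hr, LinearMap.id_apply]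

theorem exists_two_smul_sub (hf : IsSplitEmbedding f) (x : Fin 22 → ℤ) :
    ∃ v, ∀ u, intForm gramK3 ((2 : ℤ) • x - f v) (f u) = 0 := by
  obtain ⟨v, hv⟩ := exists_intForm_eq gramGamma_mul_inv ((intForm gramK3 x) ∘ₗ f)
  refine ⟨v, fun u => ?_⟩
  have h := hv u
  rw [LinearMap.comp_apply] at h
  simp only [map_sub, map_smul, LinearMap.sub_apply, LinearMap.smul_apply, hf.form, h, smul_eq_mul]
  ring

theorem castLin_injective (hf : IsSplitEmbedding f) :
    Function.Injective (castLin (ZMod 2) (LinearMap.toMatrix' f)) := by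
  obtain ⟨r, hr⟩ := hf.split
  refine Function.LeftInverse.injective (g := castLin (ZMod 2) (LinearMap.toMatrix' r)) fun u => ?_
  rw [castLin_castLin, ← LinearMap.toMatrix'_comp, hr, LinearMap.toMatrix'_id, castLin_one]

theorem finrank_rangeModTwo (hf : IsSplitEmbedding f) :
    Module.finrank (ZMod 2) (rangeModTwo f) = 10 := by
  rw [rangeModTwo, LinearMap.finrank_range_of_inj hf.castLin_injective]
  simp

theorem rangeModTwo_le_orthogonal (hf : IsSplitEmbedding f) :
    rangeModTwo f ≤ (castForm (ZMod 2) gramK3).orthogonal (rangeModTwo f) := by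
  intro x hx
  rw [LinearMap.BilinForm.mem_orthogonal_iff]
  intro y hy
  obtain ⟨u, rfl⟩ := mem_rangeModTwo.mp hx
  obtain ⟨v, rfl⟩ := mem_rangeModTwo.mp hy
  rw [castForm_castVec_eq_intForm, hf.form]
  push_cast
  rw [show (2 : ZMod 2) = 0 from rfl, zero_mul]

theorem finrank_orthogonal_rangeModTwo (W : Submodule (ZMod 2) (Fin 22 → ZMod 2)) :
    Module.finrank (ZMod 2) ((castForm (ZMod 2) gramK3).orthogonal W) =
      22 - Module.finrank (ZMod 2) W := by
  rw [LinearMap.BilinForm.finrank_orthogonal (castForm_nondegenerate gramK3_mul_inv _)]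
  simp

end IsSplitEmbedding

theorem castLin_single (R : Type*) [CommRing R] {m n : ℕ} (i : Fin m) (j : Fin n) (x : Fin n → R) :
    castLin R (Matrix.single i j 1) x = Pi.single i (x j) := by
  have h : (Matrix.single i j (1 : ℤ)).map (Int.cast : ℤ → R) = Matrix.single i j 1 := by
    simpa using Matrix.map_single i j (1 : ℤ) (Int.castRingHom R)
  rw [castLin, h, Matrix.mulVecLin_apply, Matrix.single_mulVec]
  simp [Pi.single]

theorem castForm_single_left (R : Type*) [CommRing R] {n : ℕ} {A : Matrix (Fin n) (Fin n) ℤ}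
    {i j : Fin n} (h : A i = Pi.single j 1) (x : Fin n → R) :
    castForm R A (Pi.single i 1) x = x j := by
  have h2 : ∀ k, (A i k : R) = if k = j then 1 else 0 := fun k => by
    rw [h, Pi.single_apply]; split_ifs <;> simp
  rw [castForm_apply, single_one_dotProduct, castLin, Matrix.mulVecLin_apply, Matrix.mulVec,
    dotProduct]
  simp [h2]

theorem castVec_single (R : Type*) [CommRing R] {n : ℕ} (i : Fin n) :
    castVec R (Pi.single i 1) = Pi.single i 1 := by
  ext j
  rw [castVec_apply, Pi.single_apply, Pi.single_apply]
  split_ifs <;> simp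

theorem gramK3_row_zero : gramK3 0 = Pi.single 1 1 := by decide +kernel

theorem gramK3_row_one : gramK3 1 = Pi.single 0 1 := by decide +kernel

theorem diagEmb_transpose_mul_gramK3 : diagEmbᵀ * gramK3 = gramGamma * diagEmbᵀ := by
  decide +kernel

theorem diagEmb_form : diagEmbᵀ * gramK3 * diagEmb = (2 : ℤ) • gramGamma := by decide +kernel

theorem diagEmb_decomposition :
    diagEmb * firstProj + secondEmb * diagEmbᵀ + (-2 : ℤ) • (secondEmb * firstProj) +
      (Matrix.single 0 0 1 + Matrix.single 1 1 1) = 1 := by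
  decide +kernel

/-- The reduction modulo two of the span of the diagonal copy of `Γ(2)` and one isotropic vector. -/
def diagPlane : Submodule (ZMod 2) (Fin 22 → ZMod 2) :=
  LinearMap.range (castLin (ZMod 2) diagEmb) ⊔ Submodule.span (ZMod 2) {Pi.single 0 1}

theorem finrank_diagPlane_le : Module.finrank (ZMod 2) diagPlane ≤ 11 := by
  refine (Submodule.finrank_add_le_finrank_add_finrank _ _).trans ?_
  have h1 := LinearMap.finrank_range_le (castLin (ZMod 2) diagEmb)
  have h2 := finrank_span_le_card (R := ZMod 2) ({Pi.single 0 1} : Set (Fin 22 → ZMod 2))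
  simp at h1 h2
  omega

theorem castLin_diagEmb_transpose_eq_zero (R : Type*) [CommRing R] {x : Fin 22 → R}
    (hx : ∀ u, castForm R gramK3 (castLin R diagEmb u) x = 0) : castLin R diagEmbᵀ x = 0 := by
  have h1 : castLin R gramGamma (castLin R diagEmbᵀ x) = 0 := by
    rw [castLin_castLin, ← diagEmb_transpose_mul_gramK3]
    ext i
    have h := castForm_castLin R gramK3 diagEmb 1 (Pi.single i 1) x
    rw [castLin_one, hx, single_one_dotProduct, Matrix.mul_one] at h
    exact h.symm
  have h2 := congrArg (castLin R gramGammaInv) h1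
  rwa [castLin_castLin, mul_eq_one_comm.mp gramGamma_mul_inv, castLin_one, map_zero] at h2

theorem orthogonal_diagPlane_le :
    (castForm (ZMod 2) gramK3).orthogonal diagPlane ≤ diagPlane := by
  intro x hx
  rw [LinearMap.BilinForm.mem_orthogonal_iff] at hx
  have h1 := castLin_diagEmb_transpose_eq_zero _ fun u =>
    hx _ (Submodule.mem_sup_left (LinearMap.mem_range_self _ u))
  have h2 := hx (Pi.single 0 1) (Submodule.mem_sup_right (Submodule.mem_span_singleton_self _))
  rw [castForm_single_left _ gramK3_row_zero] at h2
  have h := castLin_one (ZMod 2) x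
  rw [← diagEmb_decomposition] at h
  simp only [castLin_add, castLin_zsmul, ← castLin_castLin, h1, castLin_single, h2, map_zero] at h
  rw [← h, show ((-2 : ℤ) : ZMod 2) = 0 from rfl, zero_smul, Pi.single_zero, add_zero, add_zero,
    add_zero]
  refine Submodule.add_mem_sup (LinearMap.mem_range_self _ _)
    (Submodule.mem_span_singleton.mpr ⟨x 0, ?_⟩)
  rw [← Pi.single_smul, smul_eq_mul, mul_one]

theorem four_dvd_of_mem_diagPlane {x : Fin 22 → ℤ} (hx : castVec (ZMod 2) x ∈ diagPlane) :
    (4 : ℤ) ∣ intForm gramK3 x x := by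
  obtain ⟨_, ⟨k, rfl⟩, _, hy, hxy⟩ := Submodule.mem_sup.mp hx
  obtain ⟨a, rfl⟩ := Submodule.mem_span_singleton.mp hy
  obtain ⟨k, rfl⟩ := castVec_zmod_two_surjective k
  obtain ⟨a, rfl⟩ := ZMod.intCast_surjective a
  rw [castLin_castVec, ← castVec_single, ← castVec_zsmul, ← map_add, eq_comm, ← sub_eq_zero,
    ← map_sub] at hxy
  obtain ⟨y, hy⟩ := castVec_zmod_two_eq_zero hxy
  obtain ⟨p, hp⟩ := exists_intForm_gramGamma_self k
  obtain ⟨q, hq⟩ := exists_intForm_gramK3_self y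
  have h1 : intForm gramK3 (diagEmb *ᵥ k) (diagEmb *ᵥ k) = 2 * intForm gramGamma k k := by
    rw [intForm_apply, intForm_apply, Matrix.mulVec_mulVec, ← Matrix.vecMul_transpose,
      ← Matrix.dotProduct_mulVec, Matrix.mulVec_mulVec, ← Matrix.mul_assoc, diagEmb_form,
      Matrix.smul_mulVec, dotProduct_smul, smul_eq_mul]
  have h2 : intForm gramK3 (Pi.single 0 1) (diagEmb *ᵥ k) = 0 := by
    have h : gramK3 *ᵥ diagEmb *ᵥ k = (gramK3 * diagEmb) *ᵥ k := by rw [Matrix.mulVec_mulVec]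
    have h0 : (gramK3 * diagEmb) 0 = 0 := by decide +kernel
    rw [intForm_apply, h, single_one_dotProduct, Matrix.mulVec, h0, zero_dotProduct]
  have h3 : intForm gramK3 (Pi.single 0 1) (Pi.single 0 1) = 0 := by
    rw [intForm_apply, single_one_dotProduct, Matrix.mulVec, dotProduct_single_one]
    rfl
  have hx : x = diagEmb *ᵥ k + a • Pi.single 0 1 + (2 : ℤ) • y := by
    rw [← hy]; abel
  rw [hx]
  simp only [map_add, map_smul, LinearMap.add_apply, LinearMap.smul_apply, smul_eq_mul, h1, h2, h3,
    hp, intForm_comm gramK3_isSymm (diagEmb *ᵥ k) (Pi.single 0 1),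
    intForm_comm gramK3_isSymm y]
  exact ⟨p + a * intForm gramK3 (Pi.single 0 1) y + intForm gramK3 (diagEmb *ᵥ k) y +
    intForm gramK3 y y, by ring⟩

namespace IsSplitEmbedding

variable {f : (Fin 10 → ℤ) →ₗ[ℤ] (Fin 22 → ℤ)}

theorem exists_sub_two_smul (hf : IsSplitEmbedding f) {x : Fin 22 → ℤ}
    (hx : castVec (ZMod 2) x ∈ (castForm (ZMod 2) gramK3).orthogonal (rangeModTwo f)) :
    ∃ y : Fin 22 → ℤ, ∀ u, intForm gramK3 (x - (2 : ℤ) • y) (f u) = 0 := by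
  rw [LinearMap.BilinForm.mem_orthogonal_iff] at hx
  have h : ∀ u, ∃ k, intForm gramK3 x (f u) = 2 * k := by
    intro u
    have := hx (castVec (ZMod 2) (f u)) (mem_rangeModTwo.mpr ⟨u, rfl⟩)
    rw [castForm_castVec_eq_intForm, intForm_comm gramK3_isSymm] at this
    exact (ZMod.intCast_zmod_eq_zero_iff_dvd _ 2).mp this
  choose k hk using h
  let φ : (Fin 10 → ℤ) →ₗ[ℤ] ℤ :=
    { toFun := k
      map_add' := fun u v => by
        have := hk (u + v)
        rw [map_add, map_add, hk, hk] at this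
        omega
      map_smul' := fun c u => by
        have := hk (c • u)
        rw [map_smul, map_smul, hk, smul_eq_mul, mul_left_comm] at this
        exact (mul_left_cancel₀ two_ne_zero this).symm }
  obtain ⟨y, hy⟩ := hf.exists_dual φ
  refine ⟨y, fun u => ?_⟩
  rw [map_sub, map_smul, LinearMap.sub_apply, LinearMap.smul_apply, hy, hk]
  simp [φ]

theorem exists_four_dvd_odd (hf : IsSplitEmbedding f) :
    ∃ t t' : Fin 22 → ℤ, (∀ u, intForm gramK3 t (f u) = 0) ∧ (∀ u, intForm gramK3 t' (f u) = 0) ∧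
      (∃ k, intForm gramK3 t t = 4 * k) ∧ ∃ k, intForm gramK3 t t' = 2 * k + 1 := by
  set B := castForm (ZMod 2) gramK3 with hB
  have hnd : B.Nondegenerate := castForm_nondegenerate gramK3_mul_inv _
  have hrefl : B.IsRefl := fun x y h => by rw [hB, castForm_comm _ gramK3_isSymm]; exact h
  have hnot : ¬ B.orthogonal (diagPlane ⊔ rangeModTwo f) ≤ rangeModTwo f := by
    intro hle
    have h1 : B.orthogonal (diagPlane ⊔ rangeModTwo f) ≤ diagPlane ⊓ rangeModTwo f :=
      le_inf ((LinearMap.BilinForm.orthogonal_le le_sup_left).trans orthogonal_diagPlane_le) hle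
    have h2 := Submodule.finrank_mono h1
    rw [finrank_orthogonal_rangeModTwo] at h2
    have h3 := Submodule.finrank_sup_add_finrank_inf_eq diagPlane (rangeModTwo f)
    rw [hf.finrank_rangeModTwo] at h3
    have h4 := finrank_diagPlane_le
    omega
  obtain ⟨x, hx, hxf⟩ := Set.not_subset.mp hnot
  have hxY : x ∈ diagPlane :=
    orthogonal_diagPlane_le (LinearMap.BilinForm.orthogonal_le le_sup_left hx)
  have hxF : x ∈ B.orthogonal (rangeModTwo f) := LinearMap.BilinForm.orthogonal_le le_sup_right hx
  obtain ⟨x', hx'F, hxx'⟩ : ∃ x' ∈ B.orthogonal (rangeModTwo f), B x' x ≠ 0 := by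
    by_contra! h
    refine hxf ?_
    rw [← LinearMap.BilinForm.orthogonal_orthogonal hnd hrefl (rangeModTwo f)]
    exact LinearMap.BilinForm.mem_orthogonal_iff.mpr h
  obtain ⟨x, rfl⟩ := castVec_zmod_two_surjective x
  obtain ⟨x', rfl⟩ := castVec_zmod_two_surjective x'
  obtain ⟨y, hy⟩ := hf.exists_sub_two_smul hxF
  obtain ⟨y', hy'⟩ := hf.exists_sub_two_smul hx'F
  refine ⟨_, _, hy, hy', ?_, ?_⟩
  · obtain ⟨k, hk⟩ := four_dvd_of_mem_diagPlane hxY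
    refine ⟨k - intForm gramK3 x y + intForm gramK3 y y, ?_⟩
    simp only [map_sub, map_smul, LinearMap.sub_apply, LinearMap.smul_apply, smul_eq_mul, hk,
      intForm_comm gramK3_isSymm y x]
    ring
  · rw [hB, castForm_castVec_eq_intForm, Ne, ZMod.intCast_zmod_eq_zero_iff_dvd _ 2,
      intForm_comm gramK3_isSymm] at hxx'
    obtain ⟨k, hk⟩ : ∃ k, intForm gramK3 x x' = 2 * k + 1 := by
      rcases Int.even_or_odd' (intForm gramK3 x x') with ⟨k, hk | hk⟩
      · exact absurd ⟨k, hk⟩ hxx'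
      · exact ⟨k, hk⟩
    refine ⟨k - intForm gramK3 x y' - intForm gramK3 y x' + 2 * intForm gramK3 y y', ?_⟩
    simp only [map_sub, map_smul, LinearMap.sub_apply, LinearMap.smul_apply, smul_eq_mul, hk]
    ring

theorem exists_eq_add_two_smul (hf : IsSplitEmbedding f) {w z s : Fin 22 → ℤ}
    (hw : ∀ u, intForm gramK3 w (f u) = 0) (hz : ∀ u, intForm gramK3 z (f u) = 0)
    (hs : ∀ u, intForm gramK3 s (f u) = 0) (hww : intForm gramK3 w w = 0)
    (hzz : intForm gramK3 z z = 0) (hwz : intForm gramK3 w z = 1) (hws : intForm gramK3 w s = 0)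
    (hzs : intForm gramK3 z s = 0) : ∃ v x, s = f v + (2 : ℤ) • x := by
  set B := castForm (ZMod 2) gramK3 with hB
  have hcomm : ∀ x y, B x y = B y x := castForm_comm _ gramK3_isSymm
  have hBf : ∀ {y}, (∀ u, intForm gramK3 y (f u) = 0) → ∀ u,
      B (castVec _ y) (castLin (ZMod 2) (LinearMap.toMatrix' f) u) = 0 := by
    intro y hy u
    obtain ⟨u, rfl⟩ := castVec_zmod_two_surjective u
    rw [castLin_toMatrix', hB, castForm_castVec_eq_intForm, hy, Int.cast_zero]
  have h1 : B (castVec _ w) (castVec _ w) = 0 := by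
    rw [hB, castForm_castVec_eq_intForm, hww, Int.cast_zero]
  have h2 : B (castVec _ z) (castVec _ z) = 0 := by
    rw [hB, castForm_castVec_eq_intForm, hzz, Int.cast_zero]
  have h3 : B (castVec _ w) (castVec _ z) = 1 := by
    rw [hB, castForm_castVec_eq_intForm, hwz, Int.cast_one]
  have h4 : B (castVec _ w) (castVec _ s) = 0 := by
    rw [hB, castForm_castVec_eq_intForm, hws, Int.cast_zero]
  have h5 : B (castVec _ z) (castVec _ s) = 0 := by
    rw [hB, castForm_castVec_eq_intForm, hzs, Int.cast_zero]
  let Φ : (Fin 10 → ZMod 2) × ZMod 2 × ZMod 2 →ₗ[ZMod 2] (Fin 22 → ZMod 2) :=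
    (castLin (ZMod 2) (LinearMap.toMatrix' f)).coprod
      ((LinearMap.toSpanSingleton _ _ (castVec _ w)).coprod
        (LinearMap.toSpanSingleton _ _ (castVec _ z)))
  have hΦ : ∀ u a c, Φ (u, a, c) = castLin (ZMod 2) (LinearMap.toMatrix' f) u +
      (a • castVec _ w + c • castVec _ z) := fun u a c => by simp [Φ]
  have hinj : Function.Injective Φ := by
    rw [← LinearMap.ker_eq_bot, LinearMap.ker_eq_bot']
    rintro ⟨u, a, c⟩ h
    rw [hΦ] at h
    have hc := congrArg (B (castVec _ w)) h
    have ha := congrArg (B (castVec _ z)) h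
    simp only [map_add, map_smul, hBf hw, hBf hz, h1, h2, h3, hcomm (castVec _ z) (castVec _ w),
      smul_eq_mul, mul_zero, mul_one, zero_add, add_zero, map_zero] at ha hc
    subst ha hc
    rw [zero_smul, zero_smul, add_zero, add_zero] at h
    rw [(map_eq_zero_iff _ hf.castLin_injective).mp h]
    rfl
  have hrank := finrank_orthogonal_rangeModTwo (LinearMap.range Φ)
  rw [LinearMap.finrank_range_of_inj hinj] at hrank
  simp only [Module.finrank_prod, Module.finrank_fin_fun, Module.finrank_self] at hrank
  have hmem : ∀ y, (∀ u, B y (castLin (ZMod 2) (LinearMap.toMatrix' f) u) = 0) →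
      B (castVec _ w) y = 0 → B (castVec _ z) y = 0 → y ∈ B.orthogonal (LinearMap.range Φ) := by
    intro y hyf hwy hzy
    rw [LinearMap.BilinForm.mem_orthogonal_iff]
    rintro _ ⟨⟨u, a, c⟩, rfl⟩
    rw [hcomm, hΦ]
    simp only [map_add, map_smul, hyf, hcomm y (castVec _ w), hcomm y (castVec _ z), hwy, hzy,
      smul_zero, add_zero]
  have hle : rangeModTwo f ≤ B.orthogonal (LinearMap.range Φ) := by
    intro y hy
    refine hmem y (fun u => ?_) ?_ ?_
    · rw [hcomm]
      exact LinearMap.BilinForm.mem_orthogonal_iff.mp (hf.rangeModTwo_le_orthogonal hy) _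
        (LinearMap.mem_range_self _ _)
    · obtain ⟨u, rfl⟩ := hy
      exact hBf hw u
    · obtain ⟨u, rfl⟩ := hy
      exact hBf hz u
  have heq := Submodule.eq_of_le_of_finrank_eq hle (by rw [hf.finrank_rangeModTwo, hrank])
  obtain ⟨v, hv⟩ := mem_rangeModTwo.mp (heq.ge (hmem (castVec _ s) (hBf hs) h4 h5))
  obtain ⟨x, hx⟩ := castVec_zmod_two_eq_zero (x := s - f v) (by rw [map_sub, hv, sub_self])
  exact ⟨v, x, by rw [← hx]; abel⟩

end IsSplitEmbedding

theorem diagEmb_row_zero (u : Fin 10 → ℤ) : (diagEmb *ᵥ u) 0 = 0 := by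
  have h : diagEmb 0 = 0 := by decide +kernel
  rw [Matrix.mulVec, h, zero_dotProduct]

theorem diagEmb_row_one (u : Fin 10 → ℤ) : (diagEmb *ᵥ u) 1 = 0 := by
  have h : diagEmb 1 = 0 := by decide +kernel
  rw [Matrix.mulVec, h, zero_dotProduct]

theorem orthBasis_isDiag : (orthBasisᵀ * gramGamma * orthBasis).IsDiag := by
  unfold Matrix.IsDiag Pairwise
  decide +kernel

theorem orthBasis_diag_ne_zero : ∀ i, (orthBasisᵀ * gramGamma * orthBasis) i i ≠ 0 := by
  decide +kernel

theorem orthBasis_mul_inv : orthBasis * orthBasisInv = (60 : ℤ) • 1 := by decide +kernel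

theorem intForm_orthBasis (i j : Fin 10) :
    intForm gramGamma (orthBasis *ᵥ Pi.single i 1) (orthBasis *ᵥ Pi.single j 1) =
      (orthBasisᵀ * gramGamma * orthBasis) i j := by
  rw [intForm_apply, ← Matrix.vecMul_transpose, ← Matrix.dotProduct_mulVec, Matrix.mulVec_mulVec,
    Matrix.mulVec_mulVec, single_one_dotProduct, Matrix.mulVec_single_one]
  rfl

theorem diagEmb_intForm (u v : Fin 10 → ℤ) :
    intForm gramK3 (diagEmb *ᵥ u) (diagEmb *ᵥ v) = 2 * intForm gramGamma u v := by
  rw [intForm_apply, intForm_apply, Matrix.mulVec_mulVec, ← Matrix.vecMul_transpose,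
    ← Matrix.dotProduct_mulVec, Matrix.mulVec_mulVec, ← Matrix.mul_assoc, diagEmb_form,
    Matrix.smul_mulVec, dotProduct_smul, smul_eq_mul]

theorem castForm_gramK3_comm (x y : Fin 22 → ℚ) :
    castForm ℚ gramK3 x y = castForm ℚ gramK3 y x :=
  castForm_comm ℚ gramK3_isSymm x y

/-- Any two rational embeddings of `Γ(2)` are related by an isometry. -/
theorem exists_preservesForm_diagEmb (f : (Fin 10 → ℤ) →ₗ[ℤ] (Fin 22 → ℤ))
    (hf : ∀ u v, intForm gramK3 (f u) (f v) = 2 * intForm gramGamma u v) :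
    ∃ g : (Fin 22 → ℚ) ≃ₗ[ℚ] (Fin 22 → ℚ), PreservesForm (castForm ℚ gramK3) g ∧
      ∀ u, g (castVec ℚ (f u)) = castVec ℚ (diagEmb *ᵥ u) := by
  obtain ⟨g, hg, hgv⟩ := exists_preservesForm_extending (castForm ℚ gramK3) castForm_gramK3_comm 10
    (fun i => castVec ℚ (f (orthBasis *ᵥ Pi.single i 1)))
    (fun i => castVec ℚ (diagEmb *ᵥ (orthBasis *ᵥ Pi.single i 1)))
    (fun i j hij => by
      rw [castForm_castVec_eq_intForm, hf, intForm_orthBasis, orthBasis_isDiag hij]; simp)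
    (fun i j hij => by
      rw [castForm_castVec_eq_intForm, diagEmb_intForm, intForm_orthBasis, orthBasis_isDiag hij]
      simp)
    (fun i => by
      rw [castForm_castVec_eq_intForm, castForm_castVec_eq_intForm, hf, diagEmb_intForm])
    (fun i => by
      rw [castForm_castVec_eq_intForm, diagEmb_intForm, intForm_orthBasis]
      have := orthBasis_diag_ne_zero i
      exact_mod_cast mul_ne_zero two_ne_zero this)
  refine ⟨g, hg, fun u => ?_⟩
  let A₁ : (Fin 10 → ℤ) →ₗ[ℤ] (Fin 22 → ℚ) :=
    ((g : (Fin 22 → ℚ) →+ (Fin 22 → ℚ)).comp ((castVec ℚ).comp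
      (f ∘ₗ orthBasis.mulVecLin).toAddMonoidHom)).toIntLinearMap
  let A₂ : (Fin 10 → ℤ) →ₗ[ℤ] (Fin 22 → ℚ) :=
    ((castVec ℚ).comp (diagEmb.mulVecLin ∘ₗ orthBasis.mulVecLin).toAddMonoidHom).toIntLinearMap
  have hA : A₁ = A₂ := by
    refine LinearMap.pi_ext' fun i => LinearMap.ext_ring ?_
    exact hgv i
  have h := LinearMap.congr_fun hA (orthBasisInv *ᵥ u)
  change g (castVec ℚ (f (orthBasis *ᵥ orthBasisInv *ᵥ u))) =
    castVec ℚ (diagEmb *ᵥ orthBasis *ᵥ orthBasisInv *ᵥ u) at h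
  rw [Matrix.mulVec_mulVec u, orthBasis_mul_inv, Matrix.smul_mulVec, Matrix.one_mulVec, map_smul,
    castVec_zsmul, map_smul, Matrix.mulVec_smul, castVec_zsmul] at h
  exact smul_right_injective _ (by norm_num : ((60 : ℤ) : ℚ) ≠ 0) h

theorem gramK3_isEvenUnimodular :
    IsEvenUnimodular (castForm ℚ gramK3) (stdLattice 22) := by
  obtain ⟨L, hL⟩ := exists_gramK3_eq_add_transpose
  exact isEvenUnimodular_stdLattice hL gramK3_mul_inv

theorem gramGamma_isEvenUnimodular :
    IsEvenUnimodular (castForm ℚ gramGamma) (stdLattice 10) := by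
  obtain ⟨L, hL⟩ := exists_gramGamma_eq_add_transpose
  exact isEvenUnimodular_stdLattice hL gramGamma_mul_inv

namespace IsSplitEmbedding

variable {f : (Fin 10 → ℤ) →ₗ[ℤ] (Fin 22 → ℤ)}

theorem exists_isotropic (hf : IsSplitEmbedding f) :
    ∃ e x : Fin 22 → ℤ, (∀ u, intForm gramK3 e (f u) = 0) ∧ intForm gramK3 e e = 0 ∧
      intForm gramK3 e x = 1 := by
  obtain ⟨g, hg, hgf⟩ := exists_preservesForm_diagEmb f hf.form
  have h01 : castForm ℚ gramK3 (g.symm (Pi.single 0 1)) (g.symm (Pi.single 1 1)) ≠ 0 := by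
    rw [hg.symm, castForm_single_left _ gramK3_row_zero]
    simp
  obtain ⟨c, hc, ⟨e, he⟩, _, ⟨x, rfl⟩, hx⟩ :=
    gramK3_isEvenUnimodular.exists_primitive_smul _ _ h01
  rw [← he, castForm_castVec_eq_intForm] at hx
  refine ⟨e, x, fun u => ?_, ?_, by exact_mod_cast hx⟩
  · have : castForm ℚ gramK3 (castVec ℚ e) (castVec ℚ (f u)) = 0 := by
      rw [he, map_smul, LinearMap.smul_apply, ← hg, LinearEquiv.apply_symm_apply, hgf,
        castForm_single_left _ gramK3_row_zero, castVec_apply, diagEmb_row_one]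
      simp
    rw [castForm_castVec_eq_intForm] at this
    exact_mod_cast this
  · have : castForm ℚ gramK3 (castVec ℚ e) (castVec ℚ e) = 0 := by
      rw [he, map_smul, map_smul, LinearMap.smul_apply, hg.symm,
        castForm_single_left _ gramK3_row_zero]
      simp
    rw [castForm_castVec_eq_intForm] at this
    exact_mod_cast this

/-- Turn a dual vector of an isotropic vector into an isotropic one. -/
theorem exists_hyperbolic_of_dual {w z : Fin 22 → ℤ}
    (hw : ∀ u, intForm gramK3 w (f u) = 0) (hz : ∀ u, intForm gramK3 z (f u) = 0)
    (hww : intForm gramK3 w w = 0) (hwz : intForm gramK3 w z = 1) :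
    ∃ w z : Fin 22 → ℤ, (∀ u, intForm gramK3 w (f u) = 0) ∧ (∀ u, intForm gramK3 z (f u) = 0) ∧
      intForm gramK3 w w = 0 ∧ intForm gramK3 z z = 0 ∧ intForm gramK3 w z = 1 := by
  obtain ⟨k, hk⟩ := exists_intForm_gramK3_self z
  have hzw : intForm gramK3 z w = 1 := by rw [intForm_comm gramK3_isSymm, hwz]
  refine ⟨w, z - k • w, hw, fun u => ?_, hww, ?_, ?_⟩
  · simp [-zsmul_eq_mul, hw, hz]
  · simp only [map_sub, map_smul, LinearMap.sub_apply, LinearMap.smul_apply, smul_eq_mul, hk, hww,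
      hwz, hzw]
    ring
  · simp [-zsmul_eq_mul, hww, hwz]

theorem exists_hyperbolic (hf : IsSplitEmbedding f) :
    ∃ w z : Fin 22 → ℤ, (∀ u, intForm gramK3 w (f u) = 0) ∧ (∀ u, intForm gramK3 z (f u) = 0) ∧
      intForm gramK3 w w = 0 ∧ intForm gramK3 z z = 0 ∧ intForm gramK3 w z = 1 := by
  obtain ⟨e, x, hef, hee, hex⟩ := hf.exists_isotropic
  obtain ⟨v, hv⟩ := hf.exists_two_smul_sub x
  set m := (2 : ℤ) • x - f v with hm
  have hem : intForm gramK3 e m = 2 := by simp [-zsmul_eq_mul, hm, hef, hex]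
  have hme : intForm gramK3 m e = 2 := by rw [intForm_comm gramK3_isSymm, hem]
  have hcomm := intForm_comm gramK3_isSymm
  by_cases hodd : ∃ t k, (∀ u, intForm gramK3 t (f u) = 0) ∧ intForm gramK3 e t = 2 * k + 1
  · obtain ⟨t, k, ht, hk⟩ := hodd
    refine exists_hyperbolic_of_dual (w := e) (z := t - k • m) hef (fun u => ?_) hee ?_
    · simp [-zsmul_eq_mul, ht, hv]
    · simp only [map_sub, map_smul, hk, hem, smul_eq_mul]
      ring
  · have heven : ∀ t, (∀ u, intForm gramK3 t (f u) = 0) → ∃ k, intForm gramK3 e t = 2 * k := by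
      intro t ht
      rcases Int.even_or_odd' (intForm gramK3 e t) with ⟨k, hk | hk⟩
      · exact ⟨k, hk⟩
      · exact absurd ⟨t, k, ht, hk⟩ hodd
    obtain ⟨t, t', ht, ht', ⟨p, hp⟩, q, hq⟩ := hf.exists_four_dvd_odd
    obtain ⟨j, hj⟩ := heven t ht
    obtain ⟨j', hj'⟩ := heven t' ht'
    have htm : intForm gramK3 t m = 2 * intForm gramK3 t x := by simp [-zsmul_eq_mul, hm, ht]
    have htm' : intForm gramK3 t' m = 2 * intForm gramK3 t' x := by simp [-zsmul_eq_mul, hm, ht']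
    have hmt : intForm gramK3 m t = 2 * intForm gramK3 t x := by rw [hcomm, htm]
    have hmt' : intForm gramK3 m t' = 2 * intForm gramK3 t' x := by rw [hcomm, htm']
    obtain ⟨r, hr⟩ : ∃ r, intForm gramK3 m m = 4 * r := by
      obtain ⟨a, ha⟩ := exists_intForm_gramK3_self x
      obtain ⟨b, hb⟩ := exists_intForm_gramGamma_self v
      have h1 : intForm gramK3 m m = 2 * intForm gramK3 m x := by
        conv_lhs => rw [hm, map_sub, map_smul, ← hm, hv, sub_zero, smul_eq_mul]
      have h2 : intForm gramK3 (f v) m = 0 := by rw [hcomm, hv]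
      have h3 : intForm gramK3 (f v) m = 2 * intForm gramK3 (f v) x - 4 * b := by
        rw [hm, map_sub, map_smul, hf.form, hb, smul_eq_mul]
        ring
      have h4 : intForm gramK3 m x = 2 * intForm gramK3 x x - intForm gramK3 (f v) x := by
        simp [-zsmul_eq_mul, hm]
      exact ⟨2 * a - b, by linarith⟩
    obtain ⟨n, hn⟩ : ∃ n, intForm gramK3 (t + (1 - j) • m) (t + (1 - j) • m) = 4 * n := by
      refine ⟨p + (1 - j) * intForm gramK3 t x + (1 - j) * (1 - j) * r, ?_⟩
      simp only [map_add, map_smul, LinearMap.add_apply, LinearMap.smul_apply, smul_eq_mul, hp, htm,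
        hmt, hr]
      ring
    set s := t + (1 - j) • m with hs
    have hes : intForm gramK3 e s = 2 := by
      simp only [hs, map_add, map_smul, hj, hem, smul_eq_mul]
      ring
    have hse : intForm gramK3 s e = 2 := by rw [hcomm, hes]
    have hsf : ∀ u, intForm gramK3 s (f u) = 0 := fun u => by simp [-zsmul_eq_mul, hs, ht, hv]
    have hst' : intForm gramK3 s t' = 2 * (q + (1 - j) * intForm gramK3 t' x) + 1 := by
      simp only [hs, map_add, map_smul, LinearMap.add_apply, LinearMap.smul_apply, smul_eq_mul, hq,
        hmt']
      ring
    set k := q + (1 - j) * intForm gramK3 t' x - n * j' with hk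
    refine exists_hyperbolic_of_dual (w := s - n • e) (z := t' - k • e) (fun u => ?_)
      (fun u => ?_) ?_ ?_
    · simp [-zsmul_eq_mul, hsf, hef]
    · simp [-zsmul_eq_mul, ht', hef]
    · simp only [map_sub, map_smul, LinearMap.sub_apply, LinearMap.smul_apply, smul_eq_mul, hn, hes,
        hse, hee]
      ring
    · simp only [map_sub, map_smul, LinearMap.sub_apply, LinearMap.smul_apply, smul_eq_mul, hst',
        hse, hj', hee, hk]
      ring

end IsSplitEmbedding

/-- Any two hyperbolic pairs are related by an isometry fixing everything orthogonal to both. -/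
theorem exists_preservesForm_pair {V : Type*} [AddCommGroup V] [Module ℚ V]
    (b : LinearMap.BilinForm ℚ V) (hs : ∀ x y, b x y = b y x) (w z e f : V) (hww : b w w = 0)
    (hzz : b z z = 0) (hwz : b w z = 1) (hee : b e e = 0) (hff : b f f = 0) (hef : b e f = 1) :
    ∃ g : V ≃ₗ[ℚ] V, PreservesForm b g ∧ g w = e ∧ g z = f ∧
      ∀ y, b w y = 0 → b z y = 0 → b e y = 0 → b f y = 0 → g y = y := by
  have hzw : b z w = 1 := by rw [hs, hwz]
  have hfe : b f e = 1 := by rw [hs, hef]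
  obtain ⟨g₁, hg₁, hg₁w, hg₁y⟩ := exists_preservesForm_apply_eq b hs (w + z) (e + f)
    (by simp only [map_add, LinearMap.add_apply, hww, hzz, hwz, hzw, hee, hff, hef, hfe])
    (by simp only [map_add, LinearMap.add_apply, hee, hff, hef, hfe]; norm_num)
  obtain ⟨g₂, hg₂, hg₂w, hg₂y⟩ := exists_preservesForm_apply_eq b hs (g₁ (w - z)) (e - f)
    (by
      rw [hg₁]
      simp only [map_sub, LinearMap.sub_apply, hww, hzz, hwz, hzw, hee, hff, hef, hfe])
    (by simp only [map_sub, LinearMap.sub_apply, hee, hff, hef, hfe]; norm_num)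
  have hfix : g₂ (e + f) = e + f := by
    refine hg₂y _ ?_ ?_
    · rw [← hg₁w, hg₁]
      simp only [map_sub, map_add, LinearMap.sub_apply, hww, hzz, hwz, hzw]
      norm_num
    · simp only [map_sub, map_add, LinearMap.sub_apply, hee, hff, hef, hfe]
      norm_num
  have h1 : (g₁.trans g₂) (w + z) = e + f := by rw [LinearEquiv.trans_apply, hg₁w, hfix]
  have h2 : (g₁.trans g₂) (w - z) = e - f := by rw [LinearEquiv.trans_apply, hg₂w]
  refine ⟨g₁.trans g₂, hg₁.trans hg₂, ?_, ?_, fun y hw hz he hf => ?_⟩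
  · rw [show w = (1 / 2 : ℚ) • ((w + z) + (w - z)) by module, map_smul, map_add, h1, h2]
    module
  · rw [show z = (1 / 2 : ℚ) • ((w + z) - (w - z)) by module, map_smul, map_sub, h1, h2]
    module
  · have hy : g₁ y = y := hg₁y y (by simp [hw, hz]) (by simp [he, hf])
    rw [LinearEquiv.trans_apply, hy]
    refine hg₂y y ?_ (by simp [he, hf])
    conv_lhs => rw [← hy]
    rw [hg₁]
    simp [hw, hz]

/-- A rational isometry moving an embedding of `Γ(2)` to the diagonal one, and moving a hyperbolic
pair in its orthogonal complement to the first hyperbolic plane. -/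
structure IsAdapted (f : (Fin 10 → ℤ) →ₗ[ℤ] (Fin 22 → ℤ)) (w z : Fin 22 → ℤ)
    (g : (Fin 22 → ℚ) ≃ₗ[ℚ] (Fin 22 → ℚ)) : Prop where
  left_ortho : ∀ u, intForm gramK3 w (f u) = 0
  right_ortho : ∀ u, intForm gramK3 z (f u) = 0
  left_self : intForm gramK3 w w = 0
  right_self : intForm gramK3 z z = 0
  pairing : intForm gramK3 w z = 1
  preserves : PreservesForm (castForm ℚ gramK3) g
  map_embedding : ∀ u, g (castVec ℚ (f u)) = castVec ℚ (diagEmb *ᵥ u)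
  map_left : g (castVec ℚ w) = Pi.single 0 1
  map_right : g (castVec ℚ z) = Pi.single 1 1

theorem IsSplitEmbedding.exists_isAdapted {f : (Fin 10 → ℤ) →ₗ[ℤ] (Fin 22 → ℤ)}
    (hf : IsSplitEmbedding f) : ∃ w z g, IsAdapted f w z g := by
  obtain ⟨w, z, hwf, hzf, hww, hzz, hwz⟩ := hf.exists_hyperbolic
  obtain ⟨g, hg, hgf⟩ := exists_preservesForm_diagEmb f hf.form
  have h0 := castForm_single_left ℚ gramK3_row_zero
  have h1 := castForm_single_left ℚ gramK3_row_one
  obtain ⟨g', hg', hw, hz, hfix⟩ := exists_preservesForm_pair (castForm ℚ gramK3)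
    castForm_gramK3_comm (g (castVec ℚ w)) (g (castVec ℚ z)) (Pi.single 0 1) (Pi.single 1 1)
    (by rw [hg, castForm_castVec_eq_intForm, hww, Int.cast_zero])
    (by rw [hg, castForm_castVec_eq_intForm, hzz, Int.cast_zero])
    (by rw [hg, castForm_castVec_eq_intForm, hwz, Int.cast_one])
    (by rw [h0]; simp) (by rw [h1]; simp) (by rw [h0]; simp)
  refine ⟨w, z, g.trans g', hwf, hzf, hww, hzz, hwz, hg.trans hg', fun u => ?_, hw, hz⟩
  rw [LinearEquiv.trans_apply, hgf]
  refine hfix _ ?_ ?_ ?_ ?_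
  · rw [← hgf, hg, castForm_castVec_eq_intForm, hwf, Int.cast_zero]
  · rw [← hgf, hg, castForm_castVec_eq_intForm, hzf, Int.cast_zero]
  · rw [h0, castVec_apply, diagEmb_row_one, Int.cast_zero]
  · rw [h1, castVec_apply, diagEmb_row_zero, Int.cast_zero]

theorem antiEmb_decomposition :
    antiEmb * firstProj + secondEmb * diagEmbᵀ +
      (Matrix.single 0 0 1 + Matrix.single 1 1 1) = 1 := by
  decide +kernel

theorem antiEmb_form : antiEmbᵀ * gramK3 * antiEmb = (2 : ℤ) • gramGamma := by decide +kernel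

theorem antiEmb_form_diagEmb : antiEmbᵀ * gramK3 * diagEmb = 0 := by decide +kernel

theorem castForm_single_antiEmb (i : Fin 22) (hi : (gramK3 * antiEmb) i = 0) (y : Fin 10 → ℚ) :
    castForm ℚ gramK3 (Pi.single i 1) (castLin ℚ antiEmb y) = 0 := by
  rw [castForm_apply, castLin_castLin, single_one_dotProduct, castLin, Matrix.mulVecLin_apply,
    Matrix.mulVec, show (gramK3 * antiEmb).map (Int.cast : ℤ → ℚ) i = 0 from
      funext fun j => by rw [Matrix.map_apply, hi]; simp, zero_dotProduct]

/-- The embedding of the rational span of the Enriques lattice into the orthogonal complement. -/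
def complEmb (g : (Fin 22 → ℚ) ≃ₗ[ℚ] (Fin 22 → ℚ)) : (Fin 10 → ℚ) →ₗ[ℚ] (Fin 22 → ℚ) :=
  g.symm.toLinearMap ∘ₗ castLin ℚ antiEmb

namespace IsAdapted

variable {f : (Fin 10 → ℤ) →ₗ[ℤ] (Fin 22 → ℤ)} {w z : Fin 22 → ℤ}
  {g : (Fin 22 → ℚ) ≃ₗ[ℚ] (Fin 22 → ℚ)}

theorem exists_eq_two_mul (h : IsAdapted f w z g) (hf : IsSplitEmbedding f) {s t : Fin 22 → ℤ}
    (hs : ∀ u, intForm gramK3 s (f u) = 0) (ht : ∀ u, intForm gramK3 t (f u) = 0)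
    (hwt : intForm gramK3 w t = 0) (hzt : intForm gramK3 z t = 0) :
    ∃ k, intForm gramK3 s t = 2 * k := by
  obtain ⟨v, x, hx⟩ := hf.exists_eq_add_two_smul h.left_ortho h.right_ortho ht h.left_self
    h.right_self h.pairing hwt hzt
  exact ⟨intForm gramK3 s x, by rw [hx, map_add, hs, map_smul, smul_eq_mul, zero_add]⟩

theorem exists_self_eq_four_mul (h : IsAdapted f w z g) (hf : IsSplitEmbedding f)
    {s : Fin 22 → ℤ} (hs : ∀ u, intForm gramK3 s (f u) = 0)
    (hws : intForm gramK3 w s = 0) (hzs : intForm gramK3 z s = 0) :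
    ∃ k, intForm gramK3 s s = 4 * k := by
  obtain ⟨v, x, hx⟩ := hf.exists_eq_add_two_smul h.left_ortho h.right_ortho hs h.left_self
    h.right_self h.pairing hws hzs
  obtain ⟨a, ha⟩ := exists_intForm_gramK3_self x
  obtain ⟨b, hb⟩ := exists_intForm_gramGamma_self v
  have h1 : intForm gramK3 s s = 2 * intForm gramK3 s x := by
    conv_lhs => rw [hx, map_add, ← hx, hs, map_smul, smul_eq_mul, zero_add]
  have h2 : intForm gramK3 s (f v) = 4 * b + 2 * intForm gramK3 (f v) x := by
    rw [intForm_comm gramK3_isSymm, hx, map_add, map_smul, hf.form, hb, smul_eq_mul]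
    ring
  have h3 : intForm gramK3 s x = intForm gramK3 (f v) x + 2 * intForm gramK3 x x := by
    rw [hx, map_add, map_smul, LinearMap.add_apply, LinearMap.smul_apply, smul_eq_mul]
  rw [hs] at h2
  exact ⟨2 * a - b, by linarith⟩

theorem complEmb_form (h : IsAdapted f w z g) (x y : Fin 10 → ℚ) :
    castForm ℚ gramK3 (complEmb g x) (complEmb g y) = 2 * castForm ℚ gramGamma x y := by
  simp only [complEmb, LinearMap.comp_apply, LinearEquiv.coe_coe]
  rw [h.preserves.symm, castForm_castLin, antiEmb_form, castLin_zsmul, dotProduct_smul,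
    castForm_apply]
  simp

theorem complEmb_embedding (h : IsAdapted f w z g) (x : Fin 10 → ℚ) (u : Fin 10 → ℤ) :
    castForm ℚ gramK3 (complEmb g x) (castVec ℚ (f u)) = 0 := by
  rw [← h.preserves, h.map_embedding, complEmb, LinearMap.comp_apply, LinearEquiv.coe_coe,
    LinearEquiv.apply_symm_apply, ← castLin_castVec, castForm_castLin, antiEmb_form_diagEmb,
    castLin_zero, dotProduct_zero]

theorem left_complEmb (h : IsAdapted f w z g) (x : Fin 10 → ℚ) :
    castForm ℚ gramK3 (castVec ℚ w) (complEmb g x) = 0 := by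
  rw [← h.preserves, h.map_left, complEmb, LinearMap.comp_apply, LinearEquiv.coe_coe,
    LinearEquiv.apply_symm_apply, castForm_single_antiEmb 0 (by decide +kernel)]

theorem right_complEmb (h : IsAdapted f w z g) (x : Fin 10 → ℚ) :
    castForm ℚ gramK3 (castVec ℚ z) (complEmb g x) = 0 := by
  rw [← h.preserves, h.map_right, complEmb, LinearMap.comp_apply, LinearEquiv.coe_coe,
    LinearEquiv.apply_symm_apply, castForm_single_antiEmb 1 (by decide +kernel)]

theorem exists_complEmb_eq (h : IsAdapted f w z g) {s : Fin 22 → ℤ}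
    (hs : ∀ u, intForm gramK3 s (f u) = 0)
    (hws : intForm gramK3 w s = 0) (hzs : intForm gramK3 z s = 0) :
    ∃ x, complEmb g x = castVec ℚ s := by
  have h0 : g (castVec ℚ s) 0 = 0 := by
    rw [← castForm_single_left ℚ gramK3_row_one (g (castVec ℚ s)), ← h.map_right, h.preserves,
      castForm_castVec_eq_intForm, hzs, Int.cast_zero]
  have h1 : g (castVec ℚ s) 1 = 0 := by
    rw [← castForm_single_left ℚ gramK3_row_zero (g (castVec ℚ s)), ← h.map_left, h.preserves,
      castForm_castVec_eq_intForm, hws, Int.cast_zero]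
  have hD : castLin ℚ diagEmbᵀ (g (castVec ℚ s)) = 0 := by
    refine castLin_diagEmb_transpose_eq_zero ℚ fun u => ?_
    have hφ : (castForm ℚ gramK3 (g (castVec ℚ s))) ∘ₗ castLin ℚ diagEmb = 0 := by
      refine LinearMap.pi_ext' fun i => LinearMap.ext_ring ?_
      have := h.preserves (castVec ℚ s) (castVec ℚ (f (Pi.single i 1)))
      rw [h.map_embedding, castForm_castVec_eq_intForm, hs, Int.cast_zero, ← castLin_castVec,
        castVec_single] at this
      exact this
    rw [castForm_gramK3_comm]
    exact LinearMap.congr_fun hφ u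
  refine ⟨castLin ℚ firstProj (g (castVec ℚ s)), ?_⟩
  rw [complEmb, LinearMap.comp_apply, LinearEquiv.coe_coe, LinearEquiv.symm_apply_eq]
  have h2 := castLin_one ℚ (g (castVec ℚ s))
  rw [← antiEmb_decomposition] at h2
  simp only [castLin_add, ← castLin_castLin, castLin_single, h0, h1, hD, map_zero, Pi.single_zero,
    add_zero] at h2
  exact h2

theorem complEmb_integral (h : IsAdapted f w z g) {x : Fin 10 → ℚ} {s : Fin 22 → ℤ}
    (hs : castVec ℚ s = complEmb g x) :
    (∀ u, intForm gramK3 s (f u) = 0) ∧ intForm gramK3 w s = 0 ∧ intForm gramK3 z s = 0 := by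
  refine ⟨fun u => ?_, ?_, ?_⟩
  · have := h.complEmb_embedding x u
    rw [← hs, castForm_castVec_eq_intForm] at this
    exact_mod_cast this
  · have := h.left_complEmb x
    rw [← hs, castForm_castVec_eq_intForm] at this
    exact_mod_cast this
  · have := h.right_complEmb x
    rw [← hs, castForm_castVec_eq_intForm] at this
    exact_mod_cast this

theorem exists_decomposition (h : IsAdapted f w z g) {t : Fin 22 → ℤ}
    (ht : ∀ u, intForm gramK3 t (f u) = 0) :
    ∃ (a c : ℤ) (x : Fin 10 → ℚ), castVec ℚ (t - (a • w + c • z)) = complEmb g x := by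
  have hzw : intForm gramK3 z w = 1 := by rw [intForm_comm gramK3_isSymm, h.pairing]
  obtain ⟨x, hx⟩ := h.exists_complEmb_eq
    (s := t - (intForm gramK3 z t • w + intForm gramK3 w t • z))
    (fun u => by simp [-zsmul_eq_mul, ht, h.left_ortho, h.right_ortho])
    (by simp [-zsmul_eq_mul, h.left_self, h.pairing])
    (by simp [-zsmul_eq_mul, h.right_self, hzw])
  exact ⟨_, _, x, hx.symm⟩

theorem isEvenUnimodular_comap (h : IsAdapted f w z g) (hf : IsSplitEmbedding f) :
    IsEvenUnimodular (castForm ℚ gramGamma)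
      ((stdLattice 22).comap (complEmb g).toAddMonoidHom) where
  half_norm := by
    rintro x ⟨s, hs⟩
    change castVec ℚ s = complEmb g x at hs
    obtain ⟨h1, h2, h3⟩ := h.complEmb_integral hs
    obtain ⟨k, hk⟩ := h.exists_self_eq_four_mul hf h1 h2 h3
    have h4 := h.complEmb_form x x
    rw [← hs, castForm_castVec_eq_intForm, hk] at h4
    refine ⟨k, ?_⟩
    push_cast at h4
    rw [eq_intCast]
    linarith
  mem_iff := by
    intro x
    constructor
    · rintro ⟨s, hs⟩ y ⟨t, ht⟩
      change castVec ℚ s = complEmb g x at hs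
      change castVec ℚ t = complEmb g y at ht
      obtain ⟨h1, h2, h3⟩ := h.complEmb_integral ht
      obtain ⟨k, hk⟩ := h.exists_eq_two_mul hf (h.complEmb_integral hs).1 h1 h2 h3
      have h4 := h.complEmb_form x y
      rw [← hs, ← ht, castForm_castVec_eq_intForm, hk] at h4
      refine ⟨k, ?_⟩
      push_cast at h4
      rw [eq_intCast]
      linarith
    · intro hx
      change complEmb g x ∈ stdLattice 22
      rw [gramK3_isEvenUnimodular.mem_iff]
      rintro _ ⟨y, rfl⟩
      obtain ⟨v, hv⟩ := hf.exists_two_smul_sub y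
      obtain ⟨a, c, x', hx'⟩ := h.exists_decomposition hv
      have h1 := hx x' ⟨_, hx'⟩
      have h2 := h.complEmb_form x x'
      rw [← hx'] at h2
      simp only [map_sub, map_add, castVec_zsmul, map_smul, h.complEmb_embedding,
        castForm_gramK3_comm (complEmb g x) (castVec ℚ w),
        castForm_gramK3_comm (complEmb g x) (castVec ℚ z), h.left_complEmb, h.right_complEmb,
        smul_eq_mul] at h2
      have h3 : castForm ℚ gramK3 (complEmb g x) (castVec ℚ y) = castForm ℚ gramGamma x x' := by
        push_cast at h2
        linarith
      rwa [h3]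
  full := by
    intro x
    obtain ⟨d, hd, hx⟩ := exists_smul_mem_stdLattice (complEmb g x)
    refine ⟨d, hd, ?_⟩
    change complEmb g ((d : ℚ) • x) ∈ stdLattice 22
    rwa [map_smul]

end IsAdapted

theorem gramGamma_row_zero : gramGamma 0 = Pi.single 1 1 := by decide +kernel

theorem gramGamma_row_one : gramGamma 1 = Pi.single 0 1 := by decide +kernel

theorem castForm_gramGamma_comm (x y : Fin 10 → ℚ) :
    castForm ℚ gramGamma x y = castForm ℚ gramGamma y x :=
  castForm_comm ℚ gramGamma_isSymm x y

theorem single_mem_stdLattice {n : ℕ} (i : Fin n) : Pi.single i 1 ∈ stdLattice n := by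
  rw [← castVec_single]
  exact castVec_mem_stdLattice _

theorem stdLattice_le_of_single_mem {n : ℕ} {N : AddSubgroup (Fin n → ℚ)}
    (h : ∀ i, Pi.single i 1 ∈ N) : stdLattice n ≤ N := by
  rintro _ ⟨x, rfl⟩
  rw [← Finset.univ_sum_single x, map_sum]
  refine N.sum_mem fun i _ => ?_
  rw [← mul_one (x i), ← smul_eq_mul, Pi.single_smul, map_zsmul, castVec_single]
  exact N.zsmul_mem (h i) _

/-- An even unimodular lattice in the rational span of the Enriques lattice is isometric to the
Enriques lattice. -/
theorem IsEvenUnimodular.exists_preservesForm_stdLattice {L : AddSubgroup (Fin 10 → ℚ)}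
    (hL : IsEvenUnimodular (castForm ℚ gramGamma) L) :
    ∃ h : (Fin 10 → ℚ) ≃ₗ[ℚ] (Fin 10 → ℚ), PreservesForm (castForm ℚ gramGamma) h ∧
      ∀ x, h x ∈ L ↔ x ∈ stdLattice 10 := by
  have h0 := castForm_single_left ℚ gramGamma_row_zero
  have h1 := castForm_single_left ℚ gramGamma_row_one
  have h01 : castForm ℚ gramGamma (Pi.single 0 1) (Pi.single 1 1) = 1 := by rw [h0]; simp
  have h00 : castForm ℚ gramGamma (Pi.single 0 1) (Pi.single 0 1) = 0 := by rw [h0]; simp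
  have h11 : castForm ℚ gramGamma (Pi.single 1 1) (Pi.single 1 1) = 0 := by rw [h1]; simp
  obtain ⟨c, hc, hcL, z, hzL, hz⟩ := hL.exists_primitive_smul (Pi.single 0 1) (Pi.single 1 1)
    (by rw [h01]; norm_num)
  have hww : castForm ℚ gramGamma (c • Pi.single 0 1) (c • Pi.single 0 1) = 0 := by
    simp only [map_smul, LinearMap.smul_apply, h00, smul_zero]
  obtain ⟨z', hz'L, hz'z', hwz'⟩ :=
    hL.exists_isotropic_dual castForm_gramGamma_comm hcL hww hzL hz
  obtain ⟨g₀, hg₀, hg₀w, hg₀z, -⟩ := exists_preservesForm_pair (castForm ℚ gramGamma)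
    castForm_gramGamma_comm _ _ _ _ h00 h11 h01 hww hz'z' hwz'
  have hS := gramGamma_isEvenUnimodular
  obtain ⟨g₁, hg₁, hg₁w, hg₁z, hg₁l⟩ := (hL.comap hg₀).exists_preservesForm_mem
    castForm_gramGamma_comm (Pi.single 0 1) (Pi.single 1 1) h00 h11 h01
    (show g₀ _ ∈ L by rwa [hg₀w]) (show g₀ _ ∈ L by rwa [hg₀z])
    (List.ofFn fun i : Fin 8 => Pi.single (Fin.natAdd 2 i) 1)
    (by
      simp only [List.forall_mem_ofFn_iff]
      intro i
      rw [h0, Pi.single_eq_of_ne]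
      revert i; decide)
    (by
      simp only [List.forall_mem_ofFn_iff]
      intro i
      rw [h1, Pi.single_eq_of_ne]
      revert i; decide)
    (by
      simp only [List.forall_mem_ofFn_iff]
      exact fun i => hS.half_norm _ (single_mem_stdLattice _))
    (by
      simp only [List.forall_mem_ofFn_iff]
      exact fun i j => hS.integral (single_mem_stdLattice _) (single_mem_stdLattice _))
  simp only [List.forall_mem_ofFn_iff] at hg₁l
  have hle : stdLattice 10 ≤ (L.comap (g₀ : (Fin 10 → ℚ) →+ (Fin 10 → ℚ))).comap
      (g₁ : (Fin 10 → ℚ) →+ (Fin 10 → ℚ)) := by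
    refine stdLattice_le_of_single_mem fun i => ?_
    refine Fin.addCases (m := 2) (n := 8) (fun i => ?_) hg₁l i
    fin_cases i
    · exact hg₁w
    · exact hg₁z
  have heq := ((hL.comap hg₀).comap hg₁).eq_of_le hS hle
  refine ⟨g₁.trans g₀, hg₁.trans hg₀, fun x => ?_⟩
  rw [heq]
  rfl

/-- The projection of `U ⊕ U(2) ⊕ E8(2)` to its last ten coordinates. -/
def tailProj : Matrix (Fin 10) (Fin 12) ℤ :=
  (1 : Matrix (Fin 12) (Fin 12) ℤ).submatrix (Fin.natAdd 2) id

theorem gramUU2E82_eq :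
    gramUU2E82 = Matrix.single 0 1 1 + Matrix.single 1 0 1 +
      tailProjᵀ * ((2 : ℤ) • gramGamma) * tailProj := by
  decide +kernel

theorem tailProj_mul_transpose : tailProj * tailProjᵀ = 1 := by decide +kernel

theorem bUU2E82_eq (u v : Fin 12 → ℤ) :
    bUU2E82 u v =
      u 0 * v 1 + u 1 * v 0 + 2 * intForm gramGamma (tailProj *ᵥ u) (tailProj *ᵥ v) := by
  rw [bUU2E82, gramUU2E82_eq, Matrix.add_mulVec, Matrix.add_mulVec, dotProduct_add,
    dotProduct_add, ← Matrix.mulVec_mulVec, ← Matrix.mulVec_mulVec,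
    Matrix.dotProduct_mulVec u tailProjᵀ, Matrix.vecMul_transpose, Matrix.smul_mulVec,
    dotProduct_smul, intForm_apply, smul_eq_mul]
  simp [Matrix.single_mulVec, dotProduct, Function.update_apply]

theorem exists_mul_gramUU2E82 : ∃ M : Matrix (Fin 12) (Fin 12) ℤ, M * gramUU2E82 = (2 : ℤ) • 1 :=
  ⟨Matrix.single 0 1 2 + Matrix.single 1 0 2 + tailProjᵀ * gramGammaInv * tailProj,
    by decide +kernel⟩

theorem eq_zero_of_bUU2E82_eq_zero {v : Fin 12 → ℤ} (h : ∀ u, bUU2E82 u v = 0) : v = 0 := by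
  obtain ⟨M, hM⟩ := exists_mul_gramUU2E82
  have h1 : gramUU2E82 *ᵥ v = 0 := by
    ext i
    have := h (Pi.single i 1)
    rwa [bUU2E82, single_one_dotProduct] at this
  have h2 := congrArg (M *ᵥ ·) h1
  simp only [Matrix.mulVec_mulVec, hM, Matrix.smul_mulVec, Matrix.one_mulVec,
    Matrix.mulVec_zero] at h2
  exact (smul_eq_zero.mp h2).resolve_left two_ne_zero

/-- The orthogonal complement of an embedding of `Γ(2)` is the orthogonal sum of a hyperbolic plane
and a copy of `Γ(2)`. -/
theorem IsAdapted.exists_compl_embedding {f : (Fin 10 → ℤ) →ₗ[ℤ] (Fin 22 → ℤ)}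
    {w z : Fin 22 → ℤ} {g : (Fin 22 → ℚ) ≃ₗ[ℚ] (Fin 22 → ℚ)} (h : IsAdapted f w z g)
    (hf : IsSplitEmbedding f) :
    ∃ S : (Fin 10 → ℤ) →ₗ[ℤ] (Fin 22 → ℤ),
      (∀ x u, intForm gramK3 (S x) (f u) = 0) ∧ (∀ x, intForm gramK3 w (S x) = 0) ∧
      (∀ x, intForm gramK3 z (S x) = 0) ∧
      (∀ x y, intForm gramK3 (S x) (S y) = 2 * intForm gramGamma x y) ∧
      ∀ t, (∀ u, intForm gramK3 t (f u) = 0) → ∃ (a c : ℤ) (x : Fin 10 → ℤ),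
        t = a • w + c • z + S x := by
  obtain ⟨k, hk, hkL⟩ := (h.isEvenUnimodular_comap hf).exists_preservesForm_stdLattice
  have hex : ∀ x : Fin 10 → ℤ, ∃ s, castVec ℚ s = complEmb g (k (castVec ℚ x)) :=
    fun x => (hkL _).mpr (castVec_mem_stdLattice x)
  choose S hS using hex
  have hS_add : ∀ x y, S (x + y) = S x + S y := fun x y =>
    castVec_rat_injective (by rw [map_add, hS, hS, hS, map_add, map_add, map_add])
  have hint := fun x => h.complEmb_integral (hS x)
  refine ⟨(AddMonoidHom.mk' S hS_add).toIntLinearMap, fun x => (hint x).1, fun x => (hint x).2.1,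
    fun x => (hint x).2.2, fun x y => ?_, fun t ht => ?_⟩
  · have h1 := h.complEmb_form (k (castVec ℚ x)) (k (castVec ℚ y))
    rw [← hS, ← hS, hk, castForm_castVec_eq_intForm, castForm_castVec_eq_intForm] at h1
    exact_mod_cast h1
  · obtain ⟨a, c, x, hx⟩ := h.exists_decomposition ht
    obtain ⟨y, hy⟩ := (hkL (k.symm x)).mp (by
      rw [LinearEquiv.apply_symm_apply]
      exact ⟨_, hx⟩)
    refine ⟨a, c, y, ?_⟩
    rw [← sub_eq_iff_eq_add']
    refine castVec_rat_injective ?_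
    change _ = castVec ℚ (S y)
    rw [hx, hS, hy, LinearEquiv.apply_symm_apply]

theorem mem_orthComplK3_iff {f : (Fin 10 → ℤ) →ₗ[ℤ] (Fin 22 → ℤ)} {v : Fin 22 → ℤ} :
    v ∈ orthComplK3 f ↔ ∀ u, intForm gramK3 v (f u) = 0 := by
  simp only [intForm_apply]
  rfl

/-- For every primitive embedding of `Γ(2) = U(2) ⊕ E8(2)` into the K3 lattice
`Λ = U ⊕ U ⊕ U ⊕ E8 ⊕ E8`, the orthogonal complement of the image is isometric to
`U ⊕ U(2) ⊕ E8(2)`. -/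
theorem orthCompl_of_primitive_gamma2_in_K3
    (f : (Fin 10 → ℤ) →ₗ[ℤ] (Fin 22 → ℤ))
    (hinj : Function.Injective f)
    (hform : ∀ u v : Fin 10 → ℤ, bK3 (f u) (f v) = bGamma2 u v)
    (hprim : ∀ (n : ℤ) (x : (Fin 22 → ℤ) ⧸ LinearMap.range f), n • x = 0 → n = 0 ∨ x = 0) :
    ∃ e : ↥(orthComplK3 f) ≃ₗ[ℤ] (Fin 12 → ℤ),
      ∀ v w : ↥(orthComplK3 f), bK3 (v : Fin 22 → ℤ) (w : Fin 22 → ℤ) = bUU2E82 (e v) (e w) := by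
  have hf := isSplitEmbedding_of_primitive f hinj hform hprim
  obtain ⟨w, z, g, h⟩ := hf.exists_isAdapted
  obtain ⟨S, hSf, hwS, hzS, hSS, hdec⟩ := h.exists_compl_embedding hf
  have hzw : intForm gramK3 z w = 1 := by rw [intForm_comm gramK3_isSymm, h.pairing]
  have hSw : ∀ x, intForm gramK3 (S x) w = 0 := fun x => by rw [intForm_comm gramK3_isSymm, hwS]
  have hSz : ∀ x, intForm gramK3 (S x) z = 0 := fun x => by rw [intForm_comm gramK3_isSymm, hzS]
  let Ψ : (Fin 12 → ℤ) →ₗ[ℤ] (Fin 22 → ℤ) :=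
    (LinearMap.proj 0).smulRight w + (LinearMap.proj 1).smulRight z + S ∘ₗ tailProj.mulVecLin
  have hΨ : ∀ v, Ψ v = v 0 • w + v 1 • z + S (tailProj *ᵥ v) := fun _ => rfl
  have hΨf : ∀ v, Ψ v ∈ orthComplK3 f := by
    intro v
    rw [mem_orthComplK3_iff]
    intro u
    simp [-zsmul_eq_mul, hΨ, h.left_ortho, h.right_ortho, hSf]
  have hΨform : ∀ u v, intForm gramK3 (Ψ u) (Ψ v) = bUU2E82 u v := by
    intro u v
    rw [hΨ, hΨ, bUU2E82_eq]
    simp only [map_add, map_smul, LinearMap.add_apply, LinearMap.smul_apply, h.left_self,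
      h.right_self, h.pairing, hzw, hwS, hzS, hSw, hSz, hSS, smul_eq_mul]
    ring
  have hbij : Function.Bijective (Ψ.codRestrict (orthComplK3 f) hΨf) := by
    constructor
    · rw [injective_iff_map_eq_zero]
      intro v hv
      have hv0 : Ψ v = 0 := congrArg Subtype.val hv
      exact eq_zero_of_bUU2E82_eq_zero fun u => by rw [← hΨform, hv0, map_zero]
    · rintro ⟨t, ht⟩
      obtain ⟨a, c, x, hx⟩ := hdec t (mem_orthComplK3_iff.mp ht)
      refine ⟨Pi.single 0 a + Pi.single 1 c + tailProjᵀ *ᵥ x, Subtype.ext ?_⟩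
      have hx0 : (tailProjᵀ *ᵥ x) 0 = 0 := by
        rw [Matrix.mulVec, show tailProjᵀ 0 = 0 by decide +kernel, zero_dotProduct]
      have hx1 : (tailProjᵀ *ᵥ x) 1 = 0 := by
        rw [Matrix.mulVec, show tailProjᵀ 1 = 0 by decide +kernel, zero_dotProduct]
      have hx2 : tailProj *ᵥ (Pi.single 0 a + Pi.single 1 c + tailProjᵀ *ᵥ x) = x := by
        rw [Matrix.mulVec_add, Matrix.mulVec_mulVec, tailProj_mul_transpose, Matrix.one_mulVec,
          Matrix.mulVec_add, Matrix.mulVec_single, Matrix.mulVec_single,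
          show tailProj.col 0 = 0 by decide +kernel, show tailProj.col 1 = 0 by decide +kernel]
        simp
      rw [LinearMap.codRestrict_apply, hΨ, hx2]
      simp [-zsmul_eq_mul, hx, hx0, hx1]
  refine ⟨(LinearEquiv.ofBijective _ hbij).symm, fun v v' => ?_⟩
  obtain ⟨u, rfl⟩ := (LinearEquiv.ofBijective _ hbij).surjective v
  obtain ⟨u', rfl⟩ := (LinearEquiv.ofBijective _ hbij).surjective v'
  rw [LinearEquiv.symm_apply_apply, LinearEquiv.symm_apply_apply]
  rw [← hΨform, intForm_apply]
  rfl
end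

section
/- Let d be a positive integer. In the lattice U(2) ⊕ E8(2) with basis x, y, e1, ..., e8, let M_{2,d} be the submodule spanned by x + d·y and e1, and let N_{2,d} = {v : B(v, m) = 0 for all m ∈ M_{2,d}} be its orthogonal complement. Then N_{2,d} is a free ℤ-module of rank 8, the bilinear form restricted to N_{2,d} is negative definite, and N_{2,d} contains no vector v with B(v,v) = −2. -/
open Matrix

/-- Gram matrix of the lattice `U(2) ⊕ E8(2)` in the basis `x, y, e1, …, e8`. -/
def gramU2E82 : Matrix (Fin 10) (Fin 10) ℤ :=
  !![0, 2, 0, 0, 0, 0, 0, 0, 0, 0;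
     2, 0, 0, 0, 0, 0, 0, 0, 0, 0;
     0, 0, -4, 2, 0, 0, 0, 0, 0, 0;
     0, 0, 2, -4, 2, 0, 0, 0, 0, 0;
     0, 0, 0, 2, -4, 2, 2, 0, 0, 0;
     0, 0, 0, 0, 2, -4, 0, 0, 0, 0;
     0, 0, 0, 0, 2, 0, -4, 2, 0, 0;
     0, 0, 0, 0, 0, 0, 2, -4, 2, 0;
     0, 0, 0, 0, 0, 0, 0, 2, -4, 2;
     0, 0, 0, 0, 0, 0, 0, 0, 2, -4]

/-- The bilinear form of `U(2) ⊕ E8(2)`. -/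
def bU2E82 (v w : Fin 10 → ℤ) : ℤ := v ⬝ᵥ (gramU2E82 *ᵥ w)

/-- The orthogonal complement of a submodule of `U(2) ⊕ E8(2)`. -/
def orthCompl (M : Submodule ℤ (Fin 10 → ℤ)) : Submodule ℤ (Fin 10 → ℤ) where
  carrier := {v | ∀ m ∈ M, bU2E82 v m = 0}
  add_mem' := by
    intro a b ha hb m hm
    simp only [bU2E82, add_dotProduct] at *
    rw [ha m hm, hb m hm, add_zero]
  zero_mem' := by
    intro m hm
    simp [bU2E82]
  smul_mem' := by
    intro c v hv m hm
    simp only [bU2E82, smul_eq_mul, smul_dotProduct] at *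
    rw [hv m hm, mul_zero]

/-- The sublattice `M_{2,d}` of `U(2) ⊕ E8(2)`, spanned by `x + d·y` and `e1`. -/
def M2 (d : ℤ) : Submodule ℤ (Fin 10 → ℤ) :=
  Submodule.span ℤ {Pi.single 0 1 + d • Pi.single 1 1, Pi.single 2 1}

/-- The lattice `N_{2,d}`, the orthogonal complement of `M_{2,d}` in `U(2) ⊕ E8(2)`. -/
def N2 (d : ℤ) : Submodule ℤ (Fin 10 → ℤ) := orthCompl (M2 d)

/-- Explicit linear equations for the lattice `N_{2,d}`. -/
lemma mem_N2_iff (d : ℤ) (v : Fin 10 → ℤ) :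
    v ∈ N2 d ↔ v 1 = -d * v 0 ∧ v 3 = 2 * v 2 := by
  have hx : bU2E82 v (Pi.single 0 1 + d • Pi.single 1 1) = 2 * (v 1 + d * v 0) := by
    simp [bU2E82, gramU2E82, dotProduct, Matrix.mulVec_add, Fin.sum_univ_succ]
    ring
  have he : bU2E82 v (Pi.single 2 1) = 2 * (v 3 - 2 * v 2) := by
    simp [bU2E82, gramU2E82, dotProduct, Fin.sum_univ_succ]
    ring
  constructor
  · intro hv
    have h1 := hv _ (Submodule.subset_span (Set.mem_insert _ _))
    have h2 := hv _ (Submodule.subset_span (Set.mem_insert_of_mem _ rfl))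
    rw [hx] at h1
    rw [he] at h2
    constructor <;> linarith
  · rintro ⟨h1, h2⟩ m hm
    induction hm using Submodule.span_induction with
    | mem m hm =>
      rcases hm with rfl | rfl
      · rw [hx, h1]; ring
      · rw [he, h2]; ring
    | zero => simp [bU2E82]
    | add a b _ _ ha hb =>
      simp only [bU2E82, Matrix.mulVec_add, dotProduct_add] at *
      rw [ha, hb, add_zero]
    | smul c a _ ha =>
      simp only [bU2E82, Matrix.mulVec_smul, dotProduct_smul] at *
      rw [ha, smul_zero]

/-- The coordinates `x, e1, e3, …, e8` identify `N_{2,d}` with `ℤ⁸`. -/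
def N2Equiv (d : ℤ) : ↥(N2 d) ≃ₗ[ℤ] (Fin 8 → ℤ) where
  toFun v := ![v.1 0, v.1 2, v.1 4, v.1 5, v.1 6, v.1 7, v.1 8, v.1 9]
  map_add' v w := by simp
  map_smul' c v := by simp
  invFun c := ⟨![c 0, -d * c 0, c 1, 2 * c 1, c 2, c 3, c 4, c 5, c 6, c 7],
    (mem_N2_iff d _).2 ⟨rfl, rfl⟩⟩
  left_inv v := by
    obtain ⟨h1, h3⟩ := (mem_N2_iff d v.1).1 v.2
    ext i
    fin_cases i <;> simp [h1, h3]
  right_inv c := by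
    ext i
    fin_cases i <;> rfl

/-- The quadratic form of `U(2) ⊕ E8(2)` in coordinates. -/
lemma bU2E82_self (v : Fin 10 → ℤ) :
    bU2E82 v v = 4 * (v 0 * v 1 - (v 2 ^ 2 + v 3 ^ 2 + v 4 ^ 2 + v 5 ^ 2 + v 6 ^ 2 + v 7 ^ 2 +
      v 8 ^ 2 + v 9 ^ 2 - v 2 * v 3 - v 3 * v 4 - v 4 * v 5 - v 4 * v 6 - v 6 * v 7 -
      v 7 * v 8 - v 8 * v 9)) := by
  simp [bU2E82, gramU2E82, dotProduct, Matrix.mulVec, Fin.sum_univ_succ]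
  ring

/-- The form on `N_{2,d}` as a negative combination of squares. -/
lemma bU2E82_self_of_mem_N2 {d : ℤ} {v : Fin 10 → ℤ} (hv : v ∈ N2 d) :
    30 * bU2E82 v v = -(120 * (d * v 0 ^ 2) + 40 * (3 * v 2 - v 4) ^ 2 + 2 * v 4 ^ 2 +
      30 * (2 * v 5 - v 4) ^ 2 + 3 * (5 * v 6 - 4 * v 4) ^ 2 + 5 * (4 * v 7 - 3 * v 6) ^ 2 +
      10 * (3 * v 8 - 2 * v 7) ^ 2 + 30 * (2 * v 9 - v 8) ^ 2) := by
  obtain ⟨h1, h3⟩ := (mem_N2_iff d v).1 hv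
  rw [bU2E82_self, h1, h3]
  ring

lemma bU2E82_self_neg_of_mem_N2 {d : ℤ} (hd : 0 < d) {v : Fin 10 → ℤ} (hv : v ∈ N2 d)
    (hv0 : v ≠ 0) : bU2E82 v v < 0 := by
  contrapose! hv0
  have key := bU2E82_self_of_mem_N2 hv
  obtain ⟨h1, h3⟩ := (mem_N2_iff d v).1 hv
  have p0 : 0 ≤ d * v 0 ^ 2 := by positivity
  have p2 := sq_nonneg (3 * v 2 - v 4)
  have p4 := sq_nonneg (v 4)
  have p5 := sq_nonneg (2 * v 5 - v 4)
  have p6 := sq_nonneg (5 * v 6 - 4 * v 4)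
  have p7 := sq_nonneg (4 * v 7 - 3 * v 6)
  have p8 := sq_nonneg (3 * v 8 - 2 * v 7)
  have p9 := sq_nonneg (2 * v 9 - v 8)
  have z0 : v 0 = 0 := by
    have : d * v 0 ^ 2 = 0 := by linarith
    simpa [hd.ne'] using this
  have z2 : 3 * v 2 - v 4 = 0 := sq_eq_zero_iff.1 (by linarith)
  have z4 : v 4 = 0 := sq_eq_zero_iff.1 (by linarith)
  have z5 : 2 * v 5 - v 4 = 0 := sq_eq_zero_iff.1 (by linarith)
  have z6 : 5 * v 6 - 4 * v 4 = 0 := sq_eq_zero_iff.1 (by linarith)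
  have z7 : 4 * v 7 - 3 * v 6 = 0 := sq_eq_zero_iff.1 (by linarith)
  have z8 : 3 * v 8 - 2 * v 7 = 0 := sq_eq_zero_iff.1 (by linarith)
  have z9 : 2 * v 9 - v 8 = 0 := sq_eq_zero_iff.1 (by linarith)
  rw [z0, mul_zero] at h1
  ext i
  fin_cases i <;> simp <;> omega

/-- `N_{2,d}` is free of rank 8, negative definite, and contains no vector of
square `-2`. -/
theorem N2_free_negdef_no_minus_two (d : ℤ) (hd : 0 < d) :
    Module.Free ℤ ↥(N2 d) ∧ Module.finrank ℤ ↥(N2 d) = 8 ∧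
      (∀ v ∈ N2 d, v ≠ 0 → bU2E82 v v < 0) ∧
      (∀ v ∈ N2 d, bU2E82 v v ≠ -2) := by
  refine ⟨Module.Free.of_equiv (N2Equiv d).symm, ?_,
    fun v hv hv0 => bU2E82_self_neg_of_mem_N2 hd hv hv0, fun v _ => ?_⟩
  · rw [(N2Equiv d).finrank_eq, Module.finrank_fin_fun]
  · rw [bU2E82_self]
    omega
end

section
/- Let d be a positive integer. In the lattice U(2) ⊕ E8(2) with basis x, y, e1, ..., e8, let N_{2,d} be the orthogonal complement of the submodule spanned by x + d·y and e1. Then the discriminant group l(N_{2,d}) = N_{2,d}*/N_{2,d} is isomorphic as an abelian group to (ℤ/4dℤ) ⊕ (ℤ/4ℤ) ⊕ (ℤ/2ℤ)^6. -/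
open Matrix

/-- The same bilinear form, extended to `ℚ^10`. -/
def bQ (v w : Fin 10 → ℚ) : ℚ := v ⬝ᵥ ((gramU2E82.map (Int.cast : ℤ → ℚ)) *ᵥ w)

/-- The coordinatewise inclusion `ℤ^10 → ℚ^10`, as a `ℤ`-linear map. -/
def castQ : (Fin 10 → ℤ) →ₗ[ℤ] (Fin 10 → ℚ) where
  toFun v := fun i => (v i : ℚ)
  map_add' a b := by
    funext i
    simp only [Pi.add_apply]
    push_cast
    ring
  map_smul' c v := by
    funext i
    simp only [Pi.smul_apply, RingHom.id_apply, smul_eq_mul, zsmul_eq_mul]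
    push_cast
    ring

/-- The dual lattice `N* = {v ∈ N ⊗ ℚ : B(v, w) ∈ ℤ for all w ∈ N}` of a sublattice `N` of
`U(2) ⊕ E8(2)`, realized inside `ℚ^10` as the set of vectors of the ℚ-span of `N` pairing
integrally with `N`. -/
def dualLattice (N : Submodule ℤ (Fin 10 → ℤ)) : Submodule ℤ (Fin 10 → ℚ) where
  carrier := {v | v ∈ Submodule.span ℚ (castQ '' (N : Set (Fin 10 → ℤ))) ∧
                  ∀ w ∈ N, ∃ n : ℤ, bQ v (castQ w) = n}
  add_mem' := by
    intro a b ha hb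
    refine ⟨Submodule.add_mem _ ha.1 hb.1, fun w hw => ?_⟩
    obtain ⟨m, hm⟩ := ha.2 w hw
    obtain ⟨n, hn⟩ := hb.2 w hw
    refine ⟨m + n, ?_⟩
    simp only [bQ, add_dotProduct] at *
    rw [hm, hn]; push_cast; ring
  zero_mem' := by
    refine ⟨Submodule.zero_mem _, fun w hw => ⟨0, ?_⟩⟩
    simp [bQ]
  smul_mem' := by
    intro c v hv
    refine ⟨by
      rw [← Int.cast_smul_eq_zsmul ℚ]
      exact Submodule.smul_mem _ _ hv.1, fun w hw => ?_⟩
    obtain ⟨n, hn⟩ := hv.2 w hw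
    refine ⟨c * n, ?_⟩
    have : (c • v) = (c : ℚ) • v := (Int.cast_smul_eq_zsmul ℚ c v).symm
    simp only [bQ, this, smul_dotProduct, smul_eq_mul] at *
    rw [hn]; push_cast; ring

/-- The discriminant group `l(N) = N*/N` of a sublattice `N` of `U(2) ⊕ E8(2)`. -/
abbrev discGroup (N : Submodule ℤ (Fin 10 → ℤ)) :=
  ↥(dualLattice N) ⧸ (Submodule.comap (dualLattice N).subtype (N.map castQ))

lemma bU2E82_eq (v w : Fin 10 → ℤ) :
    bU2E82 v w = v 0 * (2 * w 1) + v 1 * (2 * w 0) + v 2 * (-4 * w 2 + 2 * w 3) +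
      v 3 * (2 * w 2 - 4 * w 3 + 2 * w 4) + v 4 * (2 * w 3 - 4 * w 4 + 2 * w 5 + 2 * w 6) +
      v 5 * (2 * w 4 - 4 * w 5) + v 6 * (2 * w 4 - 4 * w 6 + 2 * w 7) +
      v 7 * (2 * w 6 - 4 * w 7 + 2 * w 8) + v 8 * (2 * w 7 - 4 * w 8 + 2 * w 9) +
      v 9 * (2 * w 8 - 4 * w 9) := by
  simp [bU2E82, gramU2E82, dotProduct, mulVec, Fin.sum_univ_succ]
  ring

lemma bQ_eq (v w : Fin 10 → ℚ) :
    bQ v w = v 0 * (2 * w 1) + v 1 * (2 * w 0) + v 2 * (-4 * w 2 + 2 * w 3) +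
      v 3 * (2 * w 2 - 4 * w 3 + 2 * w 4) + v 4 * (2 * w 3 - 4 * w 4 + 2 * w 5 + 2 * w 6) +
      v 5 * (2 * w 4 - 4 * w 5) + v 6 * (2 * w 4 - 4 * w 6 + 2 * w 7) +
      v 7 * (2 * w 6 - 4 * w 7 + 2 * w 8) + v 8 * (2 * w 7 - 4 * w 8 + 2 * w 9) +
      v 9 * (2 * w 8 - 4 * w 9) := by
  simp [bQ, gramU2E82, dotProduct, mulVec, Fin.sum_univ_succ]
  ring

@[simp]
lemma castQ_apply (v : Fin 10 → ℤ) (i : Fin 10) : castQ v i = (v i : ℚ) := rfl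

lemma mem_orthCompl_span_pair {a b v : Fin 10 → ℤ} :
    v ∈ orthCompl (Submodule.span ℤ {a, b}) ↔ bU2E82 v a = 0 ∧ bU2E82 v b = 0 := by
  refine ⟨fun h => ⟨h a (Submodule.subset_span (by simp)), h b (Submodule.subset_span (by simp))⟩,
    fun h m hm => ?_⟩
  obtain ⟨s, t, rfl⟩ := Submodule.mem_span_pair.1 hm
  have : bU2E82 v (s • a + t • b) = s * bU2E82 v a + t * bU2E82 v b := by
    simp [bU2E82, mulVec_add, mulVec_smul, dotProduct_add, dotProduct_smul, -zsmul_eq_mul]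
  rw [this, h.1, h.2, mul_zero, mul_zero, add_zero]

lemma mem_N2 {d : ℤ} {v : Fin 10 → ℤ} : v ∈ N2 d ↔ v 1 = -d * v 0 ∧ v 3 = 2 * v 2 := by
  rw [N2, M2, mem_orthCompl_span_pair, bU2E82_eq, bU2E82_eq]
  simp
  constructor <;> rintro ⟨h, h'⟩ <;> constructor <;> linarith

/-- The vectors `(x - d y) / (4 d)`, `(e1 + 2 e2) / 4`, `e3 / 2`, …, `e8 / 2` generate the dual
lattice of `N_{2,d}`; this map sends integral coordinates to the corresponding combination. -/
def dualVec (d : ℤ) : (ℤ × ℤ × (Fin 6 → ℤ)) →+ (Fin 10 → ℚ) :=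
  AddMonoidHom.mk'
    (fun z => ![(z.1 : ℚ) / (4 * d), -d * ((z.1 : ℚ) / (4 * d)), (z.2.1 : ℚ) / 4, (z.2.1 : ℚ) / 2,
      (z.2.2 0 : ℚ) / 2, (z.2.2 1 : ℚ) / 2, (z.2.2 2 : ℚ) / 2, (z.2.2 3 : ℚ) / 2,
      (z.2.2 4 : ℚ) / 2, (z.2.2 5 : ℚ) / 2])
    (fun a b => by
      ext i
      fin_cases i <;> simp <;> ring)

lemma dualVec_apply (d : ℤ) (z : ℤ × ℤ × (Fin 6 → ℤ)) :
    dualVec d z = ![(z.1 : ℚ) / (4 * d), -d * ((z.1 : ℚ) / (4 * d)), (z.2.1 : ℚ) / 4,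
      (z.2.1 : ℚ) / 2,
      (z.2.2 0 : ℚ) / 2, (z.2.2 1 : ℚ) / 2, (z.2.2 2 : ℚ) / 2, (z.2.2 3 : ℚ) / 2,
      (z.2.2 4 : ℚ) / 2, (z.2.2 5 : ℚ) / 2] := rfl

lemma eq_of_mem_span_N2 {d : ℤ} {v : Fin 10 → ℚ}
    (hv : v ∈ Submodule.span ℚ (castQ '' (N2 d : Set (Fin 10 → ℤ)))) :
    v 1 = -d * v 0 ∧ v 3 = 2 * v 2 := by
  induction hv using Submodule.span_induction with
  | mem v hv =>
    obtain ⟨w, hw, rfl⟩ := hv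
    obtain ⟨h, h'⟩ := mem_N2.1 hw
    simp [h, h']
  | zero => simp
  | add v w _ _ hv hw =>
    simp only [Pi.add_apply, hv.1, hv.2, hw.1, hw.2]
    constructor <;> ring
  | smul c v _ hv =>
    simp only [Pi.smul_apply, smul_eq_mul, hv.1, hv.2]
    constructor <;> ring

lemma dualVec_mem {d : ℤ} (hd : d ≠ 0) (z : ℤ × ℤ × (Fin 6 → ℤ)) :
    dualVec d z ∈ dualLattice (N2 d) := by
  have hd' : (d : ℚ) ≠ 0 := by exact_mod_cast hd
  refine ⟨?_, fun w hw => ?_⟩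
  · have key : dualVec d z = (1 / (4 * d) : ℚ) • castQ ![z.1, -d * z.1, d * z.2.1, 2 * (d * z.2.1),
        2 * d * z.2.2 0, 2 * d * z.2.2 1, 2 * d * z.2.2 2, 2 * d * z.2.2 3, 2 * d * z.2.2 4,
        2 * d * z.2.2 5] := by
      ext i
      fin_cases i <;> simp [dualVec_apply] <;> field_simp <;> ring
    rw [key]
    exact Submodule.smul_mem _ _ (Submodule.subset_span ⟨_, mem_N2.2 (by simp), rfl⟩)
  · obtain ⟨h, h'⟩ := mem_N2.1 hw
    refine ⟨-z.1 * w 0 + z.2.1 * (-3 * w 2 + w 4) + z.2.2 0 * (2 * w 2 - 2 * w 4 + w 5 + w 6) +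
      z.2.2 1 * (w 4 - 2 * w 5) + z.2.2 2 * (w 4 - 2 * w 6 + w 7) +
      z.2.2 3 * (w 6 - 2 * w 7 + w 8) + z.2.2 4 * (w 7 - 2 * w 8 + w 9) +
      z.2.2 5 * (w 8 - 2 * w 9), ?_⟩
    simp [bQ_eq, dualVec_apply, h, h']
    field_simp
    ring

lemma exists_dualVec_eq {d : ℤ} (hd : d ≠ 0) {v : Fin 10 → ℚ} (hv : v ∈ dualLattice (N2 d)) :
    ∃ z, dualVec d z = v := by
  have hd' : (d : ℚ) ≠ 0 := by exact_mod_cast hd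
  obtain ⟨hs, hint⟩ := hv
  obtain ⟨h1, h3⟩ := eq_of_mem_span_N2 hs
  obtain ⟨k0, hk0⟩ := hint ![1, -d, 0, 0, 0, 0, 0, 0, 0, 0] (mem_N2.2 (by simp))
  obtain ⟨k1, hk1⟩ := hint ![0, 0, 1, 2, 0, 0, 0, 0, 0, 0] (mem_N2.2 (by simp))
  obtain ⟨k2, hk2⟩ := hint ![0, 0, 0, 0, 1, 0, 0, 0, 0, 0] (mem_N2.2 (by simp))
  obtain ⟨k3, hk3⟩ := hint ![0, 0, 0, 0, 0, 1, 0, 0, 0, 0] (mem_N2.2 (by simp))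
  obtain ⟨k4, hk4⟩ := hint ![0, 0, 0, 0, 0, 0, 1, 0, 0, 0] (mem_N2.2 (by simp))
  obtain ⟨k5, hk5⟩ := hint ![0, 0, 0, 0, 0, 0, 0, 1, 0, 0] (mem_N2.2 (by simp))
  obtain ⟨k6, hk6⟩ := hint ![0, 0, 0, 0, 0, 0, 0, 0, 1, 0] (mem_N2.2 (by simp))
  obtain ⟨k7, hk7⟩ := hint ![0, 0, 0, 0, 0, 0, 0, 0, 0, 1] (mem_N2.2 (by simp))
  simp [bQ_eq, h1, h3] at hk0 hk1 hk2 hk3 hk4 hk5 hk6 hk7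
  refine ⟨(-k0, -7*k1 - 20*k2 - 10*k3 - 16*k4 - 12*k5 - 8*k6 - 4*k7,
    ![-10*k1 - 30*k2 - 15*k3 - 24*k4 - 18*k5 - 12*k6 - 6*k7,
      -5*k1 - 15*k2 - 8*k3 - 12*k4 - 9*k5 - 6*k6 - 3*k7,
      -8*k1 - 24*k2 - 12*k3 - 20*k4 - 15*k5 - 10*k6 - 5*k7,
      -6*k1 - 18*k2 - 9*k3 - 15*k4 - 12*k5 - 8*k6 - 4*k7,
      -4*k1 - 12*k2 - 6*k3 - 10*k4 - 8*k5 - 6*k6 - 3*k7,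
      -2*k1 - 6*k2 - 3*k3 - 5*k4 - 4*k5 - 3*k6 - 2*k7]), ?_⟩
  have h0 : (-k0 : ℚ) / (4 * d) = v 0 := by
    rw [← hk0]
    field_simp
    ring
  ext i
  fin_cases i <;> simp [dualVec_apply, h0, h1, h3] <;> linarith

lemma dualVec_mem_map_iff {d : ℤ} (hd : d ≠ 0) (z : ℤ × ℤ × (Fin 6 → ℤ)) :
    dualVec d z ∈ (N2 d).map castQ ↔ 4 * d ∣ z.1 ∧ 4 ∣ z.2.1 ∧ ∀ i, 2 ∣ z.2.2 i := by
  have hd' : (d : ℚ) ≠ 0 := by exact_mod_cast hd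
  constructor
  · rintro ⟨w, -, hw⟩
    rw [dualVec_apply] at hw
    have h (i : Fin 10) := congrFun hw i
    refine ⟨⟨w 0, ?_⟩, ⟨w 2, ?_⟩, fun i => ⟨w (Fin.natAdd 4 i), ?_⟩⟩
    · have := h 0
      simp at this
      field_simp at this
      norm_cast at this
      linarith
    · have := h 2
      simp at this
      field_simp at this
      norm_cast at this
      linarith
    · have := h (Fin.natAdd 4 i)
      fin_cases i <;> simp at this ⊢ <;> field_simp at this <;> norm_cast at this <;> linarith
  · rintro ⟨⟨a, ha⟩, ⟨b, hb⟩, hc⟩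
    choose c hc using hc
    refine ⟨![a, -d * a, b, 2 * b, c 0, c 1, c 2, c 3, c 4, c 5], mem_N2.2 (by simp), ?_⟩
    ext i
    fin_cases i <;> simp [dualVec_apply, ha, hb, hc] <;> field_simp
    all_goals norm_num [mul_comm]

/-- The map from integral coordinates to the discriminant group of `N_{2,d}`. -/
def toDiscGroup {d : ℤ} (hd : d ≠ 0) : (ℤ × ℤ × (Fin 6 → ℤ)) →+ discGroup (N2 d) :=
  (Submodule.mkQ _).toAddMonoidHom.comp
    ((dualVec d).codRestrict (dualLattice (N2 d)) (dualVec_mem hd))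

lemma toDiscGroup_surjective {d : ℤ} (hd : d ≠ 0) : Function.Surjective (toDiscGroup hd) := by
  intro q
  obtain ⟨⟨v, hv⟩, rfl⟩ := Submodule.mkQ_surjective _ q
  obtain ⟨z, rfl⟩ := exists_dualVec_eq hd hv
  exact ⟨z, rfl⟩

lemma toDiscGroup_eq_zero_iff {d : ℤ} (hd : d ≠ 0) (z : ℤ × ℤ × (Fin 6 → ℤ)) :
    toDiscGroup hd z = 0 ↔ 4 * d ∣ z.1 ∧ 4 ∣ z.2.1 ∧ ∀ i, 2 ∣ z.2.2 i :=
  (Submodule.Quotient.mk_eq_zero _).trans (dualVec_mem_map_iff hd z)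

/-- Coordinatewise reduction `ℤ × ℤ × ℤ^6 → ℤ/m × ℤ/n × (ℤ/k)^6`. -/
def reduction (m n k : ℕ) :
    (ℤ × ℤ × (Fin 6 → ℤ)) →+ (ZMod m × ZMod n × (Fin 6 → ZMod k)) :=
  (Int.castAddHom _).prodMap ((Int.castAddHom _).prodMap ((Int.castAddHom _).compLeft _))

lemma reduction_surjective (m n k : ℕ) : Function.Surjective (reduction m n k) :=
  ZMod.intCast_surjective.prodMap
    (ZMod.intCast_surjective.prodMap ZMod.intCast_surjective.comp_left)

lemma reduction_eq_zero_iff (m n k : ℕ) (z : ℤ × ℤ × (Fin 6 → ℤ)) :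
    reduction m n k z = 0 ↔ (m : ℤ) ∣ z.1 ∧ (n : ℤ) ∣ z.2.1 ∧ ∀ i, (k : ℤ) ∣ z.2.2 i := by
  simp [reduction, Prod.ext_iff, funext_iff, ZMod.intCast_zmod_eq_zero_iff_dvd]

/-- The discriminant group of `N_{2,d}` is isomorphic as an abelian group to
`ℤ/4d ⊕ ℤ/4 ⊕ (ℤ/2)^6`. -/
theorem discGroup_N2 (d : ℕ) (hd : 0 < d) :
    Nonempty (discGroup (N2 (d : ℤ)) ≃+ (ZMod (4 * d) × ZMod 4 × (Fin 6 → ZMod 2))) := by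
  have hd' : (d : ℤ) ≠ 0 := by exact_mod_cast hd.ne'
  have hker : (toDiscGroup hd').ker = (reduction (4 * d) 4 2).ker := by
    ext z
    rw [AddMonoidHom.mem_ker, AddMonoidHom.mem_ker, toDiscGroup_eq_zero_iff, reduction_eq_zero_iff]
    push_cast
    rfl
  exact ⟨(QuotientAddGroup.quotientKerEquivOfSurjective _ (toDiscGroup_surjective hd')).symm.trans
    ((QuotientAddGroup.quotientAddEquivOfEq hker).trans
      (QuotientAddGroup.quotientKerEquivOfSurjective _ (reduction_surjective _ _ _)))⟩
end

section
/- Let M be a nondegenerate even ℤ-lattice, V = M ⊗ ℚ, and M* ⊆ V its dual lattice. Call a ℤ-submodule L of V an even overlattice of M if M ⊆ L ⊆ M* and B(v,v) ∈ 2ℤ for all v ∈ L (which forces B(L,L) ⊆ ℤ). Then the map L ↦ L/M is a bijection from the set of even overlattices of M onto the set of subgroups H of the discriminant group l(M) = M*/M that are isotropic for the discriminant quadratic form, i.e., such that every lift v ∈ M* of every element of H satisfies B(v,v) ∈ 2ℤ. -/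
open scoped TensorProduct

noncomputable section

namespace Stmt11

variable {M : Type} [AddCommGroup M] [Module ℤ M]

/-- The canonical inclusion `M → ℚ ⊗[ℤ] M`. -/
def incl : M →ₗ[ℤ] ℚ ⊗[ℤ] M := TensorProduct.mk ℤ ℚ M 1

/-- The ℚ-bilinear extension of an integral bilinear form to `ℚ ⊗[ℤ] M`. -/
def BQ (B : M →ₗ[ℤ] M →ₗ[ℤ] ℤ) :
    (ℚ ⊗[ℤ] M) →ₗ[ℚ] (ℚ ⊗[ℤ] M) →ₗ[ℚ] ℚ :=
  LinearMap.BilinForm.baseChange ℚ B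

/-- The dual lattice `M* = {v ∈ M ⊗ ℚ : B(v, w) ∈ ℤ for all w ∈ M}`. -/
def dualLattice (B : M →ₗ[ℤ] M →ₗ[ℤ] ℤ) : Submodule ℤ (ℚ ⊗[ℤ] M) where
  carrier := {v | ∀ w : M, ∃ n : ℤ, BQ B v (incl w) = n}
  add_mem' := by
    intro a b ha hb w
    obtain ⟨m, hm⟩ := ha w
    obtain ⟨n, hn⟩ := hb w
    exact ⟨m + n, by simp [map_add, hm, hn]⟩
  zero_mem' := fun w => ⟨0, by simp⟩
  smul_mem' := by
    intro c v hv w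
    obtain ⟨n, hn⟩ := hv w
    refine ⟨c * n, ?_⟩
    rw [LinearMap.map_smul_of_tower, LinearMap.smul_apply, hn, zsmul_eq_mul]
    push_cast
    ring

/-- The copy of `M` inside the dual lattice `M*`. -/
def latticeInDual (B : M →ₗ[ℤ] M →ₗ[ℤ] ℤ) : Submodule ℤ ↥(dualLattice B) :=
  Submodule.comap (dualLattice B).subtype (LinearMap.range (incl (M := M)))

/-- The discriminant group `l(M) = M*/M`. -/
abbrev discGroup (B : M →ₗ[ℤ] M →ₗ[ℤ] ℤ) := ↥(dualLattice B) ⧸ latticeInDual B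

/-- `L` is an even overlattice of `M`: `M ⊆ L ⊆ M*` and the form is even on `L`. -/
def IsEvenOverlattice (B : M →ₗ[ℤ] M →ₗ[ℤ] ℤ) (L : Submodule ℤ (ℚ ⊗[ℤ] M)) : Prop :=
  LinearMap.range (incl (M := M)) ≤ L ∧ L ≤ dualLattice B ∧
    ∀ v ∈ L, ∃ k : ℤ, BQ B v v = 2 * k

/-- The subgroup `L/M` of the discriminant group attached to an overlattice `L`. -/
def overlatticeQuot (B : M →ₗ[ℤ] M →ₗ[ℤ] ℤ) (L : Submodule ℤ (ℚ ⊗[ℤ] M)) :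
    Submodule ℤ (discGroup B) :=
  (Submodule.comap (dualLattice B).subtype L).map (Submodule.mkQ (latticeInDual B))

/-- A subgroup `H` of the discriminant group is isotropic for the discriminant quadratic
form: every lift `v ∈ M*` of every element of `H` satisfies `B(v,v) ∈ 2ℤ`. -/
def IsIsotropic (B : M →ₗ[ℤ] M →ₗ[ℤ] ℤ) (H : Submodule ℤ (discGroup B)) : Prop :=
  ∀ x : ↥(dualLattice B), Submodule.Quotient.mk (p := latticeInDual B) x ∈ H →
    ∃ k : ℤ, BQ B (x : ℚ ⊗[ℤ] M) (x : ℚ ⊗[ℤ] M) = 2 * k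

theorem range_incl_le_dualLattice (B : M →ₗ[ℤ] M →ₗ[ℤ] ℤ) :
    LinearMap.range (incl (M := M)) ≤ dualLattice B := by
  rintro _ ⟨v, rfl⟩ w
  exact ⟨B v w, (LinearMap.BilinForm.baseChange_tmul B (1 : ℚ) v 1 w).trans (by simp)⟩

theorem comap_mkQ_overlatticeQuot (B : M →ₗ[ℤ] M →ₗ[ℤ] ℤ) {L : Submodule ℤ (ℚ ⊗[ℤ] M)}
    (hL : LinearMap.range (incl (M := M)) ≤ L) :
    (overlatticeQuot B L).comap (latticeInDual B).mkQ = L.comap (dualLattice B).subtype := by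
  rw [overlatticeQuot, Submodule.comap_map_mkQ]
  exact sup_eq_right.mpr (Submodule.comap_mono hL)

/-- Nikulin: for a nondegenerate even lattice `M`, the assignment
`L ↦ L/M` is a bijection from even overlattices of `M` onto isotropic subgroups of the
discriminant group `l(M) = M*/M`. -/
theorem overlattice_bijection
    [Module.Free ℤ M] [Module.Finite ℤ M]
    (B : M →ₗ[ℤ] M →ₗ[ℤ] ℤ)
    (hsymm : ∀ x y : M, B x y = B y x)
    (heven : ∀ v : M, ∃ k : ℤ, B v v = 2 * k)
    (hnondeg : ∀ v : M, (∀ w : M, B v w = 0) → v = 0) :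
    (∀ L : Submodule ℤ (ℚ ⊗[ℤ] M), IsEvenOverlattice B L →
        IsIsotropic B (overlatticeQuot B L)) ∧
    (∀ H : Submodule ℤ (discGroup B), IsIsotropic B H →
        ∃! L : Submodule ℤ (ℚ ⊗[ℤ] M), IsEvenOverlattice B L ∧ overlatticeQuot B L = H) := by
  refine ⟨fun L hL x hx => ?_, fun H hH => ?_⟩
  · have hx' : x ∈ (overlatticeQuot B L).comap (latticeInDual B).mkQ := hx
    rw [comap_mkQ_overlatticeQuot B hL.1] at hx'
    exact hL.2.2 x hx'
  · refine ⟨(H.comap (latticeInDual B).mkQ).map (dualLattice B).subtype,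
      ⟨⟨fun v hv => ?_, Submodule.map_subtype_le _ _, ?_⟩, ?_⟩, ?_⟩
    · refine ⟨⟨v, range_incl_le_dualLattice B hv⟩, ?_, rfl⟩
      exact Submodule.le_comap_mkQ _ H hv
    · rintro _ ⟨x, hx, rfl⟩
      exact hH x hx
    · rw [overlatticeQuot, Submodule.comap_map_eq_of_injective (Submodule.subtype_injective _),
        Submodule.map_comap_eq_of_surjective (Submodule.mkQ_surjective _)]
    · rintro L ⟨hL, rfl⟩
      rw [comap_mkQ_overlatticeQuot B hL.1, Submodule.map_comap_subtype,
        inf_eq_right.mpr hL.2.1]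

end Stmt11
end
end

section
/- Let L be a nondegenerate even ℤ-lattice, M ⊆ L a primitive nondegenerate sublattice, and M⊥ = {v ∈ L : B(v,m) = 0 for all m ∈ M} its orthogonal complement. Then M ⊕ M⊥ has finite index in L, and the two homomorphisms from S(L) = L/(M ⊕ M⊥) to the discriminant groups l(M) = M*/M and l(M⊥) = (M⊥)*/M⊥, induced by the orthogonal projections of L ⊗ ℚ onto M ⊗ ℚ and M⊥ ⊗ ℚ respectively, are both injective. -/
open scoped TensorProduct

noncomputable section

namespace Stmt12

variable {L : Type} [AddCommGroup L] [Module ℤ L]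

/-- The canonical inclusion `L → ℚ ⊗[ℤ] L`. -/
def incl : L →ₗ[ℤ] ℚ ⊗[ℤ] L := TensorProduct.mk ℤ ℚ L 1

/-- The orthogonal complement of a submodule `M` in the lattice `(L, B)`. -/
def orth (B : L →ₗ[ℤ] L →ₗ[ℤ] ℤ) (M : Submodule ℤ L) : Submodule ℤ L where
  carrier := {v | ∀ m ∈ M, B v m = 0}
  add_mem' := by
    intro a b ha hb m hm
    simp [map_add, ha m hm, hb m hm]
  zero_mem' := by
    intro m hm
    simp
  smul_mem' := by
    intro c v hv m hm
    simp [map_smul, hv m hm]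

section

variable {N : Type} [AddCommGroup N]

/-- A vector lying in the rational span of `M` is annihilated by every integral functional
that annihilates `M`. -/
theorem apply_eq_zero_of_incl_mem_span (f : N →ₗ[ℤ] ℤ) (M : Submodule ℤ N)
    (hf : ∀ x ∈ M, f x = 0) {v : N}
    (hv : incl v ∈ Submodule.span ℚ (incl '' (M : Set N))) : f v = 0 := by
  have hincl : ∀ x, f.baseChange ℚ (incl x) = 1 ⊗ₜ[ℤ] f x := fun x =>
    LinearMap.baseChange_tmul ..
  have hker : Submodule.span ℚ (incl '' (M : Set N)) ≤ LinearMap.ker (f.baseChange ℚ) := by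
    rw [Submodule.span_le]
    rintro _ ⟨x, hx, rfl⟩
    rw [SetLike.mem_coe, LinearMap.mem_ker, hincl, hf x hx, TensorProduct.tmul_zero]
  have h := congrArg (TensorProduct.rid ℤ ℚ) (hincl v)
  rw [LinearMap.mem_ker.mp (hker hv), map_zero, TensorProduct.rid_tmul, zsmul_one] at h
  exact_mod_cast h.symm

/-- For a nondegenerate finite free lattice, some nonzero multiple of each functional is
represented by a vector. -/
theorem exists_apply_eq_smul_of_injective [Module.Free ℤ N] [Module.Finite ℤ N]
    (C : N →ₗ[ℤ] N →ₗ[ℤ] ℤ) (hC : Function.Injective C) (φ : N →ₗ[ℤ] ℤ) :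
    ∃ n : ℤ, n ≠ 0 ∧ ∃ m, C m = n • φ := by
  have hrank : Module.finrank ℤ (LinearMap.range C) = Module.finrank ℤ (Module.Dual ℤ N) := by
    rw [LinearMap.finrank_range_of_inj hC]
    exact (Module.Free.chooseBasis ℤ N).toDualEquiv.finrank_eq
  have : Finite (Module.Dual ℤ N ⧸ LinearMap.range C) :=
    Submodule.finiteQuotientOfFreeOfRankEq _ hrank
  refine ⟨Nat.card (Module.Dual ℤ N ⧸ LinearMap.range C),
    Int.natCast_ne_zero.mpr Nat.card_pos.ne', ?_⟩
  have h := AddSubgroup.nsmul_index_mem (LinearMap.range C).toAddSubgroup φ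
  rw [natCast_zsmul]
  exact h

/-- If `B` is nondegenerate on `M`, then some nonzero multiple of each vector decomposes as a sum
of a vector of `M` and a vector orthogonal to `M`. -/
theorem exists_smul_sub_mem_orth [Module.Free ℤ N] [Module.Finite ℤ N]
    (B : N →ₗ[ℤ] N →ₗ[ℤ] ℤ) (M : Submodule ℤ N)
    (hM : ∀ v ∈ M, (∀ w ∈ M, B v w = 0) → v = 0) (v : N) :
    ∃ n : ℤ, n ≠ 0 ∧ ∃ m ∈ M, n • v - m ∈ orth B M := by
  let C : M →ₗ[ℤ] M →ₗ[ℤ] ℤ := B.domRestrict₁₂ M M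
  have hC : Function.Injective C := by
    rw [injective_iff_map_eq_zero]
    intro a ha
    exact Subtype.ext (hM a a.2 fun w hw => LinearMap.congr_fun ha ⟨w, hw⟩)
  obtain ⟨n, hn, m, hm⟩ := exists_apply_eq_smul_of_injective C hC ((B v).domRestrict M)
  refine ⟨n, hn, m, m.2, fun w hw => ?_⟩
  have h : B m w = n • B v w := LinearMap.congr_fun hm ⟨w, hw⟩
  simp [h]

end

/-- for a primitive nondegenerate sublattice `M` of a nondegenerate even
lattice `L`, the sublattice `M ⊕ M⊥` has finite index in `L`, and the two homomorphisms
`S(L) = L/(M ⊕ M⊥) → l(M)` and `S(L) → l(M⊥)` induced by the orthogonal projections are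
injective; here injectivity is expressed by triviality of the kernels: whenever `v ∈ L`
decomposes as `a + b` in `L ⊗ ℚ` with `a` in the ℚ-span of `M` and `b` in the ℚ-span of
`M⊥`, if `a` (resp. `b`) comes from `M` (resp. `M⊥`) then `v ∈ M ⊕ M⊥`. -/
theorem proj_injective_on_glue_group
    [Module.Free ℤ L] [Module.Finite ℤ L]
    (B : L →ₗ[ℤ] L →ₗ[ℤ] ℤ)
    (hsymm : ∀ x y : L, B x y = B y x)
    (heven : ∀ v : L, ∃ k : ℤ, B v v = 2 * k)
    (hnondeg : ∀ v : L, (∀ w : L, B v w = 0) → v = 0)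
    (M : Submodule ℤ L)
    (hprim : ∀ (n : ℤ) (x : L ⧸ M), n • x = 0 → n = 0 ∨ x = 0)
    (hMnondeg : ∀ v ∈ M, (∀ w ∈ M, B v w = 0) → v = 0) :
    Finite (L ⧸ (M ⊔ orth B M)) ∧
    ∀ (v : L) (a b : ℚ ⊗[ℤ] L),
      a ∈ Submodule.span ℚ (incl '' (M : Set L)) →
      b ∈ Submodule.span ℚ (incl '' ((orth B M : Submodule ℤ L) : Set L)) →
      incl v = a + b →
      ((∃ u ∈ M, incl u = a) → v ∈ M ⊔ orth B M) ∧
      ((∃ u ∈ orth B M, incl u = b) → v ∈ M ⊔ orth B M) := by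
  obtain rfl : ‹Module ℤ L› = AddCommGroup.toIntModule L := Subsingleton.elim _ _
  have hdec := exists_smul_sub_mem_orth B M hMnondeg
  constructor
  · apply Module.finite_of_fg_torsion
    intro x
    obtain ⟨v, rfl⟩ := Submodule.Quotient.mk_surjective _ x
    obtain ⟨n, hn, m, hm, hr⟩ := hdec v
    refine ⟨⟨n, mem_nonZeroDivisors_of_ne_zero hn⟩, ?_⟩
    have hmem : n • v ∈ M ⊔ orth B M := by simpa using Submodule.add_mem_sup hm hr
    exact (Submodule.Quotient.mk_eq_zero _).mpr hmem
  · intro v a b ha hb hv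
    constructor
    · rintro ⟨u, hu, rfl⟩
      obtain rfl : incl (v - u) = b := by rw [map_sub, hv]; abel
      have : v - u ∈ orth B M := fun m hm => by
        refine apply_eq_zero_of_incl_mem_span (B.flip m) _ (fun x hx => ?_) hb
        exact hx m hm
      simpa using Submodule.add_mem_sup hu this
    · rintro ⟨u, hu, rfl⟩
      obtain rfl : incl (v - u) = a := by rw [map_sub, hv]; abel
      have horth : ∀ x ∈ orth B M, B x (v - u) = 0 := fun x hx =>
        apply_eq_zero_of_incl_mem_span (B x) _ (fun m hm => hx m hm) ha
      obtain ⟨n, hn, m, hm, hr⟩ := hdec (v - u)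
      have hzero : n • (v - u) - m = 0 := by
        refine hnondeg _ fun y => ?_
        obtain ⟨k, hk, p, hp, hq⟩ := hdec y
        have h1 := hr p hp
        have h2 : B (n • (v - u) - m) (k • y - p) = 0 := by
          rw [hsymm, map_sub, map_smul, horth _ hq, hq m hm]
          simp
        rw [map_sub, h1, sub_zero, map_smul, smul_eq_mul] at h2
        exact (mul_eq_zero.mp h2).resolve_left hk
      have hmem : v - u ∈ M := by
        rw [← Submodule.Quotient.mk_eq_zero]
        refine (hprim n _ ?_).resolve_left hn
        have : n • (v - u) ∈ M := by rw [sub_eq_zero.mp hzero]; exact hm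
        exact (Submodule.Quotient.mk_eq_zero _).mpr this
      simpa using Submodule.add_mem_sup hmem hu

end Stmt12
end
end
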